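/- arXiv:quant-ph/0008047 — 3 statements merged into one kernel-verified Lean document; each statement's English description precedes it below -/
import Mathlib

section
/- For any state ρ on ℂ^a ⊗ ℂ^b and any real number K > 0, F_Γ(ρ;K) equals the minimum over all Hermitian matrices D on ℂ^a ⊗ ℂ^b of Tr((ρ − D)₊) + (1/K)·Tr|D^Γ|. -/
open Matrix Filter
open scoped ComplexOrder

noncomputable section

/-- Partial transpose on the second tensor factor:
`ptrans M ((i,j),(k,l)) = M ((i,l),(k,j))`. -/
def ptrans {ι κ : Type*} (M : Matrix (ι × κ) (ι × κ) ℂ) : Matrix (ι × κ) (ι × κ) ℂ :=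
  fun x y => M (x.1, y.2) (y.1, x.2)

/-- Fidelity of `K`-state p.p.t. distillation:
the supremum of `Tr(Fρ)` over Hermitian `F` with `0 ≤ F ≤ 1` and `-1/K ≤ F^Γ ≤ 1/K`. -/
def FGamma {ι κ : Type*} [Fintype ι] [Fintype κ] [DecidableEq ι] [DecidableEq κ]
    (ρ : Matrix (ι × κ) (ι × κ) ℂ) (K : ℝ) : ℝ :=
  sSup {x : ℝ | ∃ F : Matrix (ι × κ) (ι × κ) ℂ,
    F.PosSemidef ∧ (1 - F).PosSemidef ∧
    (((1 / K : ℝ) : ℂ) • 1 - ptrans F).PosSemidef ∧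
    (ptrans F + ((1 / K : ℝ) : ℂ) • 1).PosSemidef ∧
    x = ((F * ρ).trace).re}

/-- Trace of the positive part of a Hermitian matrix: `Tr(A₊) = ∑ᵢ max(λᵢ, 0)`. -/
def tracePos {n : Type*} [Fintype n] [DecidableEq n] (A : Matrix n n ℂ) : ℝ :=
  if h : A.IsHermitian then ∑ i, max (h.eigenvalues i) 0 else 0

/-- Trace norm of a Hermitian matrix: `Tr|A| = ∑ᵢ |λᵢ|`. -/
def traceAbs {n : Type*} [Fintype n] [DecidableEq n] (A : Matrix n n ℂ) : ℝ :=
  if h : A.IsHermitian then ∑ i, |h.eigenvalues i| else 0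

section Spectral

variable {n : Type*} [Fintype n] [DecidableEq n]

lemma re_trace_mul_eq_sum_eigenvalues (F : Matrix n n ℂ) {X : Matrix n n ℂ}
    (hX : X.IsHermitian) :
    ((F * X).trace).re = ∑ i, ((star (hX.eigenvectorUnitary : Matrix n n ℂ) * F *
      (hX.eigenvectorUnitary : Matrix n n ℂ)) i i).re * hX.eigenvalues i := by
  have h : (F * X).trace = (star (hX.eigenvectorUnitary : Matrix n n ℂ) * F *
      (hX.eigenvectorUnitary : Matrix n n ℂ) *
        diagonal (RCLike.ofReal ∘ hX.eigenvalues)).trace := by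
    conv_lhs => rw [hX.spectral_theorem, Unitary.conjStarAlgAut_apply]
    rw [Matrix.mul_assoc (star _), Matrix.mul_assoc (star _), Matrix.trace_mul_comm (star _)]
    simp only [Matrix.mul_assoc]
  rw [h, Matrix.trace, Complex.re_sum]
  refine Finset.sum_congr rfl fun i _ => ?_
  simp [mul_diagonal]

omit [Fintype n] [DecidableEq n] in
lemma re_diag_nonneg {A : Matrix n n ℂ} (hA : A.PosSemidef) (i : n) : 0 ≤ (A i i).re :=
  (Complex.le_def.1 hA.diag_nonneg).1

lemma re_trace_mul_nonneg {F X : Matrix n n ℂ} (hF : F.PosSemidef) (hX : X.PosSemidef) :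
    0 ≤ ((F * X).trace).re := by
  rw [re_trace_mul_eq_sum_eigenvalues F hX.isHermitian]
  refine Finset.sum_nonneg fun i _ => mul_nonneg (re_diag_nonneg ?_ i) (hX.eigenvalues_nonneg i)
  exact hF.conjTranspose_mul_mul_same _

lemma re_trace_mul_le_tracePos {F X : Matrix n n ℂ} (hF : F.PosSemidef)
    (hF' : (1 - F).PosSemidef) (hX : X.IsHermitian) :
    ((F * X).trace).re ≤ tracePos X := by
  rw [re_trace_mul_eq_sum_eigenvalues F hX, tracePos, dif_pos hX]
  refine Finset.sum_le_sum fun i _ => ?_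
  have h0 := re_diag_nonneg
    (hF.conjTranspose_mul_mul_same (hX.eigenvectorUnitary : Matrix n n ℂ)) i
  have h1 := re_diag_nonneg
    (hF'.conjTranspose_mul_mul_same (hX.eigenvectorUnitary : Matrix n n ℂ)) i
  rw [← star_eq_conjTranspose] at h0 h1
  rw [Matrix.mul_sub, Matrix.sub_mul, Matrix.mul_one, Unitary.coe_star_mul_self] at h1
  simp only [Matrix.sub_apply, one_apply_eq, Complex.sub_re, Complex.one_re] at h1
  rcases le_total 0 (hX.eigenvalues i) with h | h
  · rw [max_eq_left h]
    nlinarith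
  · rw [max_eq_right h]
    exact mul_nonpos_of_nonneg_of_nonpos h0 h

lemma exists_re_trace_mul_eq_tracePos {X : Matrix n n ℂ} (hX : X.IsHermitian) :
    ∃ P : Matrix n n ℂ, P.PosSemidef ∧ (1 - P).PosSemidef ∧
      ((P * X).trace).re = tracePos X := by
  set U : Matrix n n ℂ := (hX.eigenvectorUnitary : Matrix n n ℂ) with hU
  have hUU : U * star U = 1 := Unitary.coe_mul_star_self _
  have hUU' : star U * U = 1 := Unitary.coe_star_mul_self _
  set d : n → ℂ := fun i => if 0 ≤ hX.eigenvalues i then 1 else 0 with hd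
  refine ⟨U * diagonal d * Uᴴ, ?_, ?_, ?_⟩
  · refine (PosSemidef.diagonal fun i => ?_).mul_mul_conjTranspose_same U
    simp only [hd, Pi.zero_apply]
    split_ifs <;> simp
  · have h : 1 - U * diagonal d * Uᴴ = U * diagonal (1 - d) * Uᴴ := by
      have h1 : diagonal (1 - d) = 1 - diagonal d := by
        rw [← diagonal_one, diagonal_sub]
        rfl
      rw [h1, Matrix.mul_sub, Matrix.sub_mul, Matrix.mul_one, ← star_eq_conjTranspose, hUU]
    rw [h]
    refine (PosSemidef.diagonal fun i => ?_).mul_mul_conjTranspose_same U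
    simp only [hd, Pi.zero_apply, Pi.sub_apply, Pi.one_apply]
    split_ifs <;> simp
  · rw [re_trace_mul_eq_sum_eigenvalues _ hX, tracePos, dif_pos hX, ← hU]
    refine Finset.sum_congr rfl fun i _ => ?_
    have h : star U * (U * diagonal d * Uᴴ) * U = diagonal d := by
      rw [← star_eq_conjTranspose]
      calc star U * (U * diagonal d * star U) * U
          = (star U * U) * diagonal d * (star U * U) := by simp only [Matrix.mul_assoc]
        _ = diagonal d := by rw [hUU', Matrix.one_mul, Matrix.mul_one]
    rw [h, diagonal_apply_eq, hd]
    rcases le_or_gt 0 (hX.eigenvalues i) with h | h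
    · simp [h]
    · simp [h.not_ge, h.le]

lemma tracePos_nonneg (X : Matrix n n ℂ) : 0 ≤ tracePos X := by
  unfold tracePos
  split_ifs
  · exact Finset.sum_nonneg fun i _ => le_max_right _ _
  · exact le_rfl

lemma tracePos_neg_nonpos {X : Matrix n n ℂ} (hX : X.PosSemidef) : tracePos (-X) ≤ 0 := by
  obtain ⟨P, hP, -, h⟩ := exists_re_trace_mul_eq_tracePos hX.isHermitian.neg
  rw [← h]
  simpa using re_trace_mul_nonneg hP hX

lemma tracePos_le_re_trace {X : Matrix n n ℂ} (hX : X.PosSemidef) :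
    tracePos X ≤ X.trace.re := by
  obtain ⟨P, -, hP, h⟩ := exists_re_trace_mul_eq_tracePos hX.isHermitian
  rw [← h]
  simpa [Matrix.sub_mul] using re_trace_mul_nonneg hP hX

lemma tracePos_add_le {X Y : Matrix n n ℂ} (hX : X.IsHermitian) (hY : Y.IsHermitian) :
    tracePos (X + Y) ≤ tracePos X + tracePos Y := by
  obtain ⟨P, hP, hP', h⟩ := exists_re_trace_mul_eq_tracePos (hX.add hY)
  rw [← h, Matrix.mul_add, trace_add, Complex.add_re]
  exact add_le_add (re_trace_mul_le_tracePos hP hP' hX) (re_trace_mul_le_tracePos hP hP' hY)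

omit [Fintype n] [DecidableEq n] in
lemma isHermitian_real_smul {X : Matrix n n ℂ} (hX : X.IsHermitian) (c : ℝ) :
    (c • X).IsHermitian :=
  hX.smul (IsSelfAdjoint.all c)

lemma tracePos_smul_le {X : Matrix n n ℂ} (hX : X.IsHermitian) {c : ℝ} (hc : 0 ≤ c) :
    tracePos (c • X) ≤ c * tracePos X := by
  obtain ⟨P, hP, hP', h⟩ := exists_re_trace_mul_eq_tracePos (isHermitian_real_smul hX c)
  rw [← h, Matrix.mul_smul, trace_smul, Complex.smul_re]
  exact mul_le_mul_of_nonneg_left (re_trace_mul_le_tracePos hP hP' hX) hc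

lemma traceAbs_eq {X : Matrix n n ℂ} (hX : X.IsHermitian) :
    traceAbs X = 2 * tracePos X - X.trace.re := by
  have h := re_trace_mul_eq_sum_eigenvalues 1 hX
  rw [Matrix.one_mul, Matrix.mul_one, Unitary.coe_star_mul_self] at h
  rw [h, traceAbs, tracePos, dif_pos hX, dif_pos hX, Finset.mul_sum, ← Finset.sum_sub_distrib]
  refine Finset.sum_congr rfl fun i _ => ?_
  rcases le_total 0 (hX.eigenvalues i) with h | h
  · rw [max_eq_left h, abs_of_nonneg h, one_apply_eq, Complex.one_re]
    ring
  · rw [max_eq_right h, abs_of_nonpos h, one_apply_eq, Complex.one_re]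
    ring

lemma norm_apply_le_traceAbs {X : Matrix n n ℂ} (hX : X.IsHermitian) (i j : n) :
    ‖X i j‖ ≤ traceAbs X := by
  have hU := hX.eigenvectorUnitary.2
  have h : X i j = ∑ k, (hX.eigenvectorUnitary : Matrix n n ℂ) i k * (hX.eigenvalues k : ℂ) *
      star ((hX.eigenvectorUnitary : Matrix n n ℂ) j k) := by
    conv_lhs => rw [hX.spectral_theorem, Unitary.conjStarAlgAut_apply]
    rw [mul_apply]
    refine Finset.sum_congr rfl fun k _ => ?_
    rw [mul_diagonal, star_apply]
    rfl
  rw [h, traceAbs, dif_pos hX]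
  refine (norm_sum_le _ _).trans (Finset.sum_le_sum fun k _ => ?_)
  rw [norm_mul, norm_mul, norm_star, Complex.norm_real, Real.norm_eq_abs]
  have h1 := entry_norm_bound_of_unitary hU i k
  have h2 := entry_norm_bound_of_unitary hU j k
  calc _ ≤ 1 * |hX.eigenvalues k| * 1 := by gcongr
    _ = _ := by ring

lemma re_trace_mul_le_traceAbs {G Y : Matrix n n ℂ} {c : ℝ} (hc : 0 < c)
    (hG : ((c : ℂ) • 1 - G).PosSemidef) (hG' : (G + (c : ℂ) • 1).PosSemidef)
    (hY : Y.IsHermitian) :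
    ((G * Y).trace).re ≤ c * traceAbs Y := by
  have hc2 : (0 : ℂ) ≤ ((2 * c)⁻¹ : ℝ) := by
    rw [Complex.zero_le_real]
    positivity
  have hcc : (c : ℂ) ≠ 0 := by exact_mod_cast hc.ne'
  have h1 : (1 - ((2 * c)⁻¹ : ℝ) • (G + (c : ℂ) • 1) : Matrix n n ℂ)
      = (((2 * c)⁻¹ : ℝ) : ℂ) • ((c : ℂ) • 1 - G) := by
    ext i j
    simp only [Matrix.sub_apply, Matrix.smul_apply, Matrix.add_apply, Complex.real_smul, smul_eq_mul]
    push_cast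
    field_simp
    ring
  have h2 := re_trace_mul_le_tracePos (F := ((2 * c)⁻¹ : ℝ) • (G + (c : ℂ) • 1))
    (hG'.smul (by positivity : (0 : ℝ) ≤ (2 * c)⁻¹)) (h1 ▸ hG.smul hc2) hY
  rw [Matrix.smul_mul, trace_smul, Complex.smul_re, smul_eq_mul, inv_mul_le_iff₀ (by positivity),
    Matrix.add_mul, Matrix.smul_mul, Matrix.one_mul, trace_add, trace_smul, smul_eq_mul,
    Complex.add_re, Complex.re_ofReal_mul] at h2
  rw [traceAbs_eq hY]
  linarith

omit [DecidableEq n] in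
lemma posSemidef_of_re_trace_mul_nonneg {F : Matrix n n ℂ} (hF : F.IsHermitian)
    (h : ∀ X : Matrix n n ℂ, X.PosSemidef → 0 ≤ ((F * X).trace).re) : F.PosSemidef := by
  refine .of_dotProduct_mulVec_nonneg hF fun x => ?_
  have h1 := h _ (posSemidef_vecMulVec_self_star x)
  rw [mul_vecMulVec, trace_vecMulVec, dotProduct_comm] at h1
  have h2 := hF.im_star_dotProduct_mulVec_self x
  rw [Complex.le_def]
  exact ⟨h1, h2.symm⟩

end Spectral

section TraceNorm

variable {n : Type*} [Fintype n] [DecidableEq n]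

lemma traceAbs_add_le {X Y : Matrix n n ℂ} (hX : X.IsHermitian) (hY : Y.IsHermitian) :
    traceAbs (X + Y) ≤ traceAbs X + traceAbs Y := by
  rw [traceAbs_eq (hX.add hY), traceAbs_eq hX, traceAbs_eq hY, trace_add, Complex.add_re]
  linarith [tracePos_add_le hX hY]

lemma traceAbs_smul_le {X : Matrix n n ℂ} (hX : X.IsHermitian) {c : ℝ} (hc : 0 ≤ c) :
    traceAbs (c • X) ≤ c * traceAbs X := by
  rw [traceAbs_eq (isHermitian_real_smul hX c), traceAbs_eq hX, trace_smul, Complex.smul_re,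
    smul_eq_mul]
  linarith [tracePos_smul_le hX hc]

lemma traceAbs_nonneg (X : Matrix n n ℂ) : 0 ≤ traceAbs X := by
  unfold traceAbs
  split_ifs
  · exact Finset.sum_nonneg fun i _ => abs_nonneg _
  · exact le_rfl

lemma traceAbs_le_re_trace {X : Matrix n n ℂ} (hX : X.PosSemidef) :
    traceAbs X ≤ X.trace.re := by
  rw [traceAbs_eq hX.isHermitian]
  linarith [tracePos_le_re_trace hX]

lemma traceAbs_neg_le_re_trace {X : Matrix n n ℂ} (hX : X.PosSemidef) :
    traceAbs (-X) ≤ X.trace.re := by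
  rw [traceAbs_eq hX.isHermitian.neg, trace_neg, Complex.neg_re]
  linarith [tracePos_neg_nonpos hX]

lemma tracePos_zero : tracePos (0 : Matrix n n ℂ) = 0 :=
  le_antisymm (by simpa using tracePos_le_re_trace (PosSemidef.zero (n := n) (R := ℂ)))
    (tracePos_nonneg _)

lemma traceAbs_zero : traceAbs (0 : Matrix n n ℂ) = 0 :=
  le_antisymm (by simpa using traceAbs_le_re_trace (PosSemidef.zero (n := n) (R := ℂ)))
    (traceAbs_nonneg _)

end TraceNorm

section PartialTranspose

variable {ι κ : Type*}

lemma ptrans_ptrans (M : Matrix (ι × κ) (ι × κ) ℂ) : ptrans (ptrans M) = M := rfl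

lemma ptrans_add (M N : Matrix (ι × κ) (ι × κ) ℂ) : ptrans (M + N) = ptrans M + ptrans N := rfl

lemma ptrans_zero : ptrans (0 : Matrix (ι × κ) (ι × κ) ℂ) = 0 := rfl

lemma ptrans_real_smul (c : ℝ) (M : Matrix (ι × κ) (ι × κ) ℂ) :
    ptrans (c • M) = c • ptrans M := rfl

lemma Matrix.IsHermitian.ptrans {M : Matrix (ι × κ) (ι × κ) ℂ} (hM : M.IsHermitian) :
    (ptrans M).IsHermitian :=
  IsHermitian.ext fun x y => hM.apply (x.1, y.2) (y.1, x.2)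

lemma trace_ptrans_mul [Fintype ι] [Fintype κ] (M N : Matrix (ι × κ) (ι × κ) ℂ) :
    (ptrans M * N).trace = (M * ptrans N).trace := by
  simp only [Matrix.trace, Matrix.diag_apply, Matrix.mul_apply, ptrans, Fintype.sum_prod_type]
  refine Finset.sum_congr rfl fun i _ => ?_
  rw [Finset.sum_comm]
  conv_rhs => rw [Finset.sum_comm]
  refine Finset.sum_congr rfl fun k _ => ?_
  rw [Finset.sum_comm]

end PartialTranspose

section Hermitian

variable (n : Type*)

/-- The real vector space of Hermitian matrices. -/
abbrev HermitianSpace : Submodule ℝ (Matrix n n ℂ) := selfAdjoint.submodule ℝ (Matrix n n ℂ)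

variable {n}

lemma isHermitian_coe (X : HermitianSpace n) : (X : Matrix n n ℂ).IsHermitian := X.2

variable [Fintype n]

lemma exists_eq_re_trace_mul (f : HermitianSpace n →ₗ[ℝ] ℝ) :
    ∃ F : Matrix n n ℂ, F.IsHermitian ∧ ∀ X : HermitianSpace n, f X = ((F * X).trace).re := by
  let B : HermitianSpace n →ₗ[ℝ] Module.Dual ℝ (HermitianSpace n) :=
    LinearMap.mk₂ ℝ (fun F X => ((F * X : Matrix n n ℂ).trace).re)
      (by intros; simp [Matrix.add_mul]) (by intros; simp)
      (by intros; simp [Matrix.mul_add]) (by intros; simp)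
  have hB : Function.Injective B := by
    rw [injective_iff_map_eq_zero]
    intro X hX
    have h : (((X : Matrix n n ℂ) * X).trace).re = 0 := LinearMap.congr_fun hX X
    have h1 := posSemidef_conjTranspose_mul_self (X : Matrix n n ℂ)
    have h2 : ((X : Matrix n n ℂ)ᴴ * X).trace = 0 := by
      apply Complex.ext
      · rw [(isHermitian_coe X).eq, h, Complex.zero_re]
      · exact (Complex.le_def.1 h1.trace_nonneg).2.symm
    exact Subtype.ext (trace_conjTranspose_mul_self_eq_zero_iff.1 h2)
  obtain ⟨F, hF⟩ := (LinearMap.injective_iff_surjective_of_finrank_eq_finrank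
    Subspace.dual_finrank_eq.symm).1 hB f
  exact ⟨F, isHermitian_coe F, fun X => (LinearMap.congr_fun hF X).symm⟩

variable [DecidableEq n]

open scoped Matrix.Norms.Elementwise

lemma continuous_tracePos : Continuous fun X : HermitianSpace n => tracePos (X : Matrix n n ℂ) := by
  rw [← continuousOn_univ]
  refine ConvexOn.continuousOn isOpen_univ ⟨convex_univ, fun X _ Y _ s t hs ht _ => ?_⟩
  exact (tracePos_add_le (isHermitian_real_smul (isHermitian_coe X) s)
    (isHermitian_real_smul (isHermitian_coe Y) t)).trans
    (add_le_add (tracePos_smul_le (isHermitian_coe X) hs) (tracePos_smul_le (isHermitian_coe Y) ht))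

lemma continuous_traceAbs : Continuous fun X : HermitianSpace n => traceAbs (X : Matrix n n ℂ) := by
  simp_rw [fun X : HermitianSpace n => traceAbs_eq (isHermitian_coe X)]
  exact (continuous_tracePos.const_mul 2).sub
    (Complex.continuous_re.comp continuous_subtype_val.matrix_trace)

lemma norm_le_traceAbs (X : HermitianSpace n) : ‖X‖ ≤ traceAbs (X : Matrix n n ℂ) :=
  (Matrix.norm_le_iff (traceAbs_nonneg _)).2 fun i j =>
    norm_apply_le_traceAbs (isHermitian_coe X) i j

end Hermitian

section Dual

variable {ι κ : Type*} [Fintype ι] [Fintype κ] [DecidableEq ι] [DecidableEq κ]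

/-- The objective function of the dual program. -/
def dualObjective (K : ℝ) (X D : Matrix (ι × κ) (ι × κ) ℂ) : ℝ :=
  tracePos (X - D) + (1 / K) * traceAbs (ptrans D)

lemma dualObjective_add_le {K : ℝ} (hK : 0 < K) {X Y D E : Matrix (ι × κ) (ι × κ) ℂ}
    (hX : X.IsHermitian) (hY : Y.IsHermitian) (hD : D.IsHermitian) (hE : E.IsHermitian) :
    dualObjective K (X + Y) (D + E) ≤ dualObjective K X D + dualObjective K Y E := by
  have h1 := tracePos_add_le (hX.sub hD) (hY.sub hE)
  have h2 := mul_le_mul_of_nonneg_left (traceAbs_add_le hD.ptrans hE.ptrans)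
    (by positivity : 0 ≤ 1 / K)
  unfold dualObjective
  rw [add_sub_add_comm, ptrans_add]
  linarith

lemma dualObjective_smul_le {K : ℝ} (hK : 0 < K) {X D : Matrix (ι × κ) (ι × κ) ℂ}
    (hX : X.IsHermitian) (hD : D.IsHermitian) {c : ℝ} (hc : 0 ≤ c) :
    dualObjective K (c • X) (c • D) ≤ c * dualObjective K X D := by
  have h1 := tracePos_smul_le (hX.sub hD) hc
  have h2 := mul_le_mul_of_nonneg_left (traceAbs_smul_le hD.ptrans hc)
    (by positivity : 0 ≤ 1 / K)
  unfold dualObjective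
  rw [← smul_sub, ptrans_real_smul]
  linarith

open scoped Matrix.Norms.Elementwise in
lemma exists_forall_dualObjective_le {K : ℝ} (hK : 0 < K) (X : HermitianSpace (ι × κ)) :
    ∃ D : HermitianSpace (ι × κ), ∀ E : HermitianSpace (ι × κ),
      dualObjective K (X : Matrix (ι × κ) (ι × κ) ℂ) D ≤ dualObjective K (X : Matrix (ι × κ) (ι × κ) ℂ) E := by
  let Γ : HermitianSpace (ι × κ) → HermitianSpace (ι × κ) :=
    fun D => ⟨ptrans D, (isHermitian_coe D).ptrans⟩
  have hΓ : Continuous Γ := by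
    refine Continuous.subtype_mk (continuous_matrix fun x y => ?_) _
    exact continuous_subtype_val.matrix_elem _ _
  have hnorm (D : HermitianSpace (ι × κ)) : ‖D‖ ≤ ‖Γ D‖ :=
    (Matrix.norm_le_iff (norm_nonneg _)).2 fun x y =>
      Matrix.norm_entry_le_entrywise_sup_norm (Γ D : Matrix (ι × κ) (ι × κ) ℂ)
        (i := (x.1, y.2)) (j := (y.1, x.2))
  have hcont : Continuous fun D : HermitianSpace (ι × κ) =>
      dualObjective K (X : Matrix (ι × κ) (ι × κ) ℂ) D :=
    (continuous_tracePos.comp (continuous_const.sub continuous_id)).add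
      ((continuous_traceAbs.comp hΓ).const_mul (1 / K))
  have : ProperSpace (HermitianSpace (ι × κ)) := FiniteDimensional.proper_real _
  refine hcont.exists_forall_le (tendsto_atTop_mono (fun D => ?_)
    ((tendsto_norm_cocompact_atTop (E := HermitianSpace (ι × κ))).const_mul_atTop
      (by positivity : 0 < 1 / K)))
  have h := mul_le_mul_of_nonneg_left ((hnorm D).trans (norm_le_traceAbs (Γ D)))
    (by positivity : 0 ≤ 1 / K)
  exact h.trans (le_add_of_nonneg_left (tracePos_nonneg _))

/-- Feasibility for the primal program defining `FGamma`. -/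
def PrimalFeasible (K : ℝ) (F : Matrix (ι × κ) (ι × κ) ℂ) : Prop :=
  F.PosSemidef ∧ (1 - F).PosSemidef ∧
    (((1 / K : ℝ) : ℂ) • 1 - ptrans F).PosSemidef ∧
    (ptrans F + ((1 / K : ℝ) : ℂ) • 1).PosSemidef

lemma PrimalFeasible.re_trace_mul_le {K : ℝ} (hK : 0 < K) {F X D : Matrix (ι × κ) (ι × κ) ℂ}
    (hF : PrimalFeasible K F) (hX : X.IsHermitian) (hD : D.IsHermitian) :
    ((F * X).trace).re ≤ dualObjective K X D := by
  have h1 := re_trace_mul_le_tracePos hF.1 hF.2.1 (hX.sub hD)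
  have h2 := re_trace_mul_le_traceAbs (one_div_pos.2 hK) hF.2.2.1 hF.2.2.2 hD.ptrans
  rw [trace_ptrans_mul, ptrans_ptrans] at h2
  rw [Matrix.mul_sub, trace_sub, Complex.sub_re] at h1
  unfold dualObjective
  linarith

lemma PrimalFeasible.of_re_trace_mul_le {K : ℝ} (hK : 0 < K) {F : Matrix (ι × κ) (ι × κ) ℂ}
    (hF : F.IsHermitian)
    (h : ∀ X D : Matrix (ι × κ) (ι × κ) ℂ, X.IsHermitian → D.IsHermitian →
      ((F * X).trace).re ≤ dualObjective K X D) : PrimalFeasible K F := by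
  have hpos (X : Matrix (ι × κ) (ι × κ) ℂ) (hX : X.IsHermitian) :
      ((F * X).trace).re ≤ tracePos X := by
    simpa [dualObjective, ptrans_zero, traceAbs_zero] using h X 0 hX isHermitian_zero
  have habs (Y : Matrix (ι × κ) (ι × κ) ℂ) (hY : Y.IsHermitian) :
      ((ptrans F * Y).trace).re ≤ 1 / K * traceAbs Y := by
    simpa only [dualObjective, ptrans_ptrans, sub_self, tracePos_zero, zero_add,
      trace_ptrans_mul] using h (ptrans Y) (ptrans Y) hY.ptrans hY.ptrans
  have h1 : (((1 / K : ℝ) : ℂ) • (1 : Matrix (ι × κ) (ι × κ) ℂ)).IsHermitian := by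
    rw [Complex.coe_smul]
    exact isHermitian_real_smul isHermitian_one _
  have h1_trace (Y : Matrix (ι × κ) (ι × κ) ℂ) :
      (((((1 / K : ℝ) : ℂ) • (1 : Matrix (ι × κ) (ι × κ) ℂ)) * Y).trace).re
        = 1 / K * Y.trace.re := by
    rw [Matrix.smul_mul, Matrix.one_mul, trace_smul, smul_eq_mul, Complex.re_ofReal_mul]
  have hK' : 0 ≤ 1 / K := by positivity
  refine ⟨posSemidef_of_re_trace_mul_nonneg hF fun X hX => ?_,
    posSemidef_of_re_trace_mul_nonneg (isHermitian_one.sub hF) fun X hX => ?_,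
    posSemidef_of_re_trace_mul_nonneg (h1.sub hF.ptrans) fun Y hY => ?_,
    posSemidef_of_re_trace_mul_nonneg (hF.ptrans.add h1) fun Y hY => ?_⟩
  · have h2 := (hpos _ hX.isHermitian.neg).trans (tracePos_neg_nonpos hX)
    rw [Matrix.mul_neg, trace_neg, Complex.neg_re] at h2
    linarith
  · have h2 := (hpos _ hX.isHermitian).trans (tracePos_le_re_trace hX)
    rw [Matrix.sub_mul, Matrix.one_mul, trace_sub, Complex.sub_re]
    linarith
  · have h2 := (habs _ hY.isHermitian).trans
      (mul_le_mul_of_nonneg_left (traceAbs_le_re_trace hY) hK')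
    rw [Matrix.sub_mul, trace_sub, Complex.sub_re, h1_trace]
    linarith
  · have h2 := (habs _ hY.isHermitian.neg).trans
      (mul_le_mul_of_nonneg_left (traceAbs_neg_le_re_trace hY) hK')
    rw [Matrix.mul_neg, trace_neg, Complex.neg_re] at h2
    rw [Matrix.add_mul, trace_add, Complex.add_re, h1_trace]
    linarith

lemma exists_primalFeasible_eq_dualObjective {K : ℝ} (hK : 0 < K)
    {ρ : Matrix (ι × κ) (ι × κ) ℂ} (hρ : ρ.IsHermitian) (hρ0 : ρ ≠ 0) :
    ∃ F D : Matrix (ι × κ) (ι × κ) ℂ, PrimalFeasible K F ∧ D.IsHermitian ∧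
      ((F * ρ).trace).re = dualObjective K ρ D := by
  choose m hm using fun X : HermitianSpace (ι × κ) => exists_forall_dualObjective_le hK X
  let p : HermitianSpace (ι × κ) → ℝ :=
    fun X => dualObjective K (X : Matrix (ι × κ) (ι × κ) ℂ) (m X)
  have p_add (X Y : HermitianSpace (ι × κ)) : p (X + Y) ≤ p X + p Y :=
    (hm (X + Y) (m X + m Y)).trans (dualObjective_add_le hK (isHermitian_coe X) (isHermitian_coe Y)
      (isHermitian_coe (m X)) (isHermitian_coe (m Y)))
  have p_smul_le (c : ℝ) (hc : 0 ≤ c) (X : HermitianSpace (ι × κ)) : p (c • X) ≤ c * p X :=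
    (hm (c • X) (c • m X)).trans (dualObjective_smul_le hK (isHermitian_coe X)
      (isHermitian_coe (m X)) hc)
  have p_smul (c : ℝ) (hc : 0 < c) (X : HermitianSpace (ι × κ)) : p (c • X) = c * p X := by
    refine (p_smul_le c hc.le X).antisymm ?_
    have h := p_smul_le c⁻¹ (by positivity) (c • X)
    rwa [inv_smul_smul₀ hc.ne', ← div_eq_inv_mul, le_div_iff₀' hc] at h
  have p_nonneg (X : HermitianSpace (ι × κ)) : 0 ≤ p X :=
    add_nonneg (tracePos_nonneg _) (mul_nonneg (by positivity) (traceAbs_nonneg _))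
  let r : HermitianSpace (ι × κ) := ⟨ρ, hρ⟩
  have hr : r ≠ 0 := fun h => hρ0 (congrArg Subtype.val h)
  obtain ⟨f, hf, hfp⟩ := exists_extension_of_le_sublinear
    (LinearPMap.mkSpanSingleton r (p r) hr) p p_smul p_add (by
      rintro ⟨x, hx⟩
      obtain ⟨c, rfl⟩ := Submodule.mem_span_singleton.1 hx
      rw [LinearPMap.mkSpanSingleton'_apply, RingHom.id_apply, smul_eq_mul]
      rcases le_or_gt c 0 with hc | hc
      · exact (mul_nonpos_of_nonpos_of_nonneg hc (p_nonneg r)).trans (p_nonneg _)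
      · exact (p_smul c hc r).ge)
  obtain ⟨F, hFH, hF⟩ := exists_eq_re_trace_mul f
  refine ⟨F, m r, .of_re_trace_mul_le hK hFH fun X D hX hD => ?_, isHermitian_coe (m r), ?_⟩
  · exact (hF ⟨X, hX⟩).symm.le.trans ((hfp ⟨X, hX⟩).trans (hm ⟨X, hX⟩ ⟨D, hD⟩))
  · rw [← hF r, hf ⟨r, Submodule.mem_span_singleton_self r⟩, LinearPMap.mkSpanSingleton_apply]

end Dual

/-- Dual semidefinite program: `F_Γ(ρ;K)` equals the minimum over Hermitian `D` of
`Tr((ρ-D)₊) + (1/K) Tr|D^Γ|`, and the minimum is attained. -/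
theorem FGamma_dual_sdp {a b : ℕ}
    (ρ : Matrix (Fin a × Fin b) (Fin a × Fin b) ℂ)
    (hρ : ρ.PosSemidef) (hρtr : ρ.trace = 1) (K : ℝ) (hK : 0 < K) :
    IsLeast {x : ℝ | ∃ D : Matrix (Fin a × Fin b) (Fin a × Fin b) ℂ,
        D.IsHermitian ∧ x = tracePos (ρ - D) + (1 / K) * traceAbs (ptrans D)}
      (FGamma ρ K) := by
  have hρ0 : ρ ≠ 0 := by
    rintro rfl
    simp at hρtr
  obtain ⟨F, D, hF, hD, hFD⟩ := exists_primalFeasible_eq_dualObjective hK hρ.isHermitian hρ0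
  have hmax : IsGreatest {x : ℝ | ∃ F : Matrix (Fin a × Fin b) (Fin a × Fin b) ℂ,
      F.PosSemidef ∧ (1 - F).PosSemidef ∧
      (((1 / K : ℝ) : ℂ) • 1 - ptrans F).PosSemidef ∧
      (ptrans F + ((1 / K : ℝ) : ℂ) • 1).PosSemidef ∧
      x = ((F * ρ).trace).re} ((F * ρ).trace).re := by
    refine ⟨⟨F, hF.1, hF.2.1, hF.2.2.1, hF.2.2.2, rfl⟩, ?_⟩
    rintro _ ⟨G, h1, h2, h3, h4, rfl⟩
    exact hFD ▸ PrimalFeasible.re_trace_mul_le hK ⟨h1, h2, h3, h4⟩ hρ.isHermitian hD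
  rw [FGamma, hmax.csSup_eq]
  refine ⟨⟨D, hD, hFD⟩, ?_⟩
  rintro _ ⟨E, hE, rfl⟩
  exact hF.re_trace_mul_le hK hρ.isHermitian hE
end
end

section
/- For any states ρ₁ and ρ₂ on bipartite systems: D_Γ(ρ₁) + D_Γ(ρ₂) ≤ D_Γ(ρ₁ ⊗ ρ₂) ≤ D_Γ(ρ₁) + log₂ Tr|ρ₂^Γ|. In particular, D_Γ(ρ ⊗ Φ(d)) = D_Γ(ρ) + log₂ d for every integer d ≥ 1, and D_Γ(ρ ⊗ ρ') = D_Γ(ρ) for any state ρ' whose partial transpose is positive semidefinite. Throughout, tensor products of bipartite states are regarded as bipartite by grouping the two first factors against the two second factors. -/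
open Matrix Filter
open scoped ComplexOrder

noncomputable section

/-- `n`-fold tensor power of a bipartite matrix, regrouped as a bipartite matrix. -/
def tpow {ι κ : Type*} (ρ : Matrix (ι × κ) (ι × κ) ℂ) (n : ℕ) :
    Matrix ((Fin n → ι) × (Fin n → κ)) ((Fin n → ι) × (Fin n → κ)) ℂ :=
  fun x y => ∏ i, ρ (x.1 i, x.2 i) (y.1 i, y.2 i)

/-- p.p.t. distillable entanglement. -/
def DGamma {ι κ : Type*} [Fintype ι] [Fintype κ] [DecidableEq ι] [DecidableEq κ]
    (ρ : Matrix (ι × κ) (ι × κ) ℂ) : ℝ :=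
  sSup {r : ℝ | 0 ≤ r ∧
    Tendsto (fun n : ℕ => FGamma (tpow ρ n) ((⌊(2 : ℝ) ^ (r * (n : ℝ))⌋ : ℤ) : ℝ))
      atTop (nhds 1)}

/-- The maximally entangled state `Φ(d) = (1/d) ∑ |ii⟩⟨jj|`. -/
def maxEnt (d : ℕ) : Matrix (Fin d × Fin d) (Fin d × Fin d) ℂ :=
  fun x y => if x.1 = x.2 ∧ y.1 = y.2 then (1 / (d : ℂ)) else 0

/-- Tensor product of two bipartite matrices, regrouped as a bipartite matrix
(first factors against second factors). -/
def tensorBip {ι₁ κ₁ ι₂ κ₂ : Type*}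
    (ρ₁ : Matrix (ι₁ × κ₁) (ι₁ × κ₁) ℂ) (ρ₂ : Matrix (ι₂ × κ₂) (ι₂ × κ₂) ℂ) :
    Matrix ((ι₁ × ι₂) × (κ₁ × κ₂)) ((ι₁ × ι₂) × (κ₁ × κ₂)) ℂ :=
  fun x y => ρ₁ (x.1.1, x.2.1) (y.1.1, y.2.1) * ρ₂ (x.1.2, x.2.2) (y.1.2, y.2.2)

theorem Matrix.PosSemidef.half_smul {m : Type*} {X : Matrix m m ℂ} (hX : X.PosSemidef) :
    ((1 / 2 : ℂ) • X).PosSemidef :=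
  hX.smul (by rw [Complex.le_def]; norm_num)

/-- `S` dominates `A` when `-S ≤ A ≤ S` in the Loewner order. -/
def Dominates {n : Type*} (S A : Matrix n n ℂ) : Prop :=
  (S - A).PosSemidef ∧ (A + S).PosSemidef

theorem Dominates.submatrix {n n' : Type*} {S A : Matrix n n ℂ} (h : Dominates S A) (e : n' → n) :
    Dominates (S.submatrix e e) (A.submatrix e e) :=
  ⟨h.1.submatrix e, h.2.submatrix e⟩

section LinearAlgebra

variable {m p : Type*} [Fintype m] [Fintype p]

open scoped MatrixOrder Matrix.Norms.L2Operator in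
theorem Matrix.PosSemidef.exists_eq_conjTranspose_mul_self {B : Matrix p p ℂ}
    (hB : B.PosSemidef) : ∃ C : Matrix p p ℂ, B = Cᴴ * C := by
  classical
  obtain ⟨C, hC⟩ := CStarAlgebra.nonneg_iff_eq_star_mul_self.mp hB.nonneg
  exact ⟨C, hC⟩

theorem Matrix.PosSemidef.trace_mul_nonneg {X B : Matrix p p ℂ}
    (hX : X.PosSemidef) (hB : B.PosSemidef) : 0 ≤ (X * B).trace := by
  obtain ⟨C, rfl⟩ := hB.exists_eq_conjTranspose_mul_self
  rw [← Matrix.mul_assoc, Matrix.trace_mul_comm, ← Matrix.mul_assoc]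
  exact (hX.mul_mul_conjTranspose_same C).trace_nonneg

theorem posSemidef_of_mul_self_eq {A : Matrix m m ℂ} (hA : A.IsHermitian) (h : A * A = A) :
    A.PosSemidef := by
  have := Matrix.posSemidef_conjTranspose_mul_self A
  rwa [hA.eq, h] at this

/-- Partial trace over the second factor of `X * (1 ⊗ B)`. -/
def sliceTrace (X : Matrix (m × p) (m × p) ℂ) (B : Matrix p p ℂ) : Matrix m m ℂ :=
  fun x y => ∑ u, ∑ v, X (x, u) (y, v) * B v u

theorem sliceTrace_posSemidef {X : Matrix (m × p) (m × p) ℂ} {B : Matrix p p ℂ}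
    (hX : X.PosSemidef) (hB : B.PosSemidef) : (sliceTrace X B).PosSemidef := by
  classical
  obtain ⟨C, rfl⟩ := hB.exists_eq_conjTranspose_mul_self
  let V : p → Matrix m (m × p) ℂ := fun w => Matrix.of fun x q => if x = q.1 then C w q.2 else 0
  have h : sliceTrace X (Cᴴ * C) = ∑ w, V w * X * (V w)ᴴ := by
    ext x y
    have hV : ∀ w, (V w * X * (V w)ᴴ) x y =
        ∑ v, ∑ u, C w u * X (x, u) (y, v) * star (C w v) := by
      intro w
      simp only [Matrix.mul_apply, Fintype.sum_prod_type, Matrix.conjTranspose_apply, V,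
        Matrix.of_apply, apply_ite star, star_zero, mul_ite, mul_zero, ite_mul, zero_mul, Finset.sum_mul]
      rw [Finset.sum_eq_single y (fun b _ hb => by simp [hb.symm]) (by simp)]
      simp only [if_true]
      refine Finset.sum_congr rfl fun v _ => ?_
      rw [Finset.sum_eq_single x (fun b _ hb => by simp [hb.symm]) (by simp)]
      simp
    rw [Matrix.sum_apply]
    simp only [hV, sliceTrace, Matrix.mul_apply, Matrix.conjTranspose_apply, Finset.mul_sum]
    rw [Finset.sum_comm]
    conv_rhs => rw [Finset.sum_comm]
    refine Finset.sum_congr rfl fun v _ => ?_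
    rw [Finset.sum_comm]
    refine Finset.sum_congr rfl fun w _ => Finset.sum_congr rfl fun u _ => ?_
    ring
  rw [h]
  exact Matrix.posSemidef_sum _ fun w _ => hX.mul_mul_conjTranspose_same (V w)

theorem Dominates.sliceTrace {S A : Matrix (m × p) (m × p) ℂ} {T B : Matrix p p ℂ}
    (h : Dominates S A) (h' : Dominates T B) :
    Dominates (sliceTrace S T) (sliceTrace A B) := by
  constructor
  · convert! ((sliceTrace_posSemidef h.1 h'.2).add (sliceTrace_posSemidef h.2 h'.1)).half_smul
      using 1
    ext x y
    simp only [_root_.sliceTrace, Matrix.sub_apply, Matrix.add_apply, Matrix.smul_apply,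
      smul_eq_mul, ← Finset.sum_add_distrib, ← Finset.sum_sub_distrib, Finset.mul_sum]
    exact Finset.sum_congr rfl fun u _ => Finset.sum_congr rfl fun v _ => by ring
  · convert! ((sliceTrace_posSemidef h.1 h'.1).add (sliceTrace_posSemidef h.2 h'.2)).half_smul
      using 1
    ext x y
    simp only [_root_.sliceTrace, Matrix.sub_apply, Matrix.add_apply, Matrix.smul_apply,
      smul_eq_mul, ← Finset.sum_add_distrib, Finset.mul_sum]
    exact Finset.sum_congr rfl fun u _ => Finset.sum_congr rfl fun v _ => by ring

theorem Dominates.re_trace_mul_le {S A T B : Matrix p p ℂ}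
    (h : Dominates S A) (h' : Dominates T B) : (A * B).trace.re ≤ (S * T).trace.re := by
  have h₁ := (Complex.le_def.1 (h.1.trace_mul_nonneg h'.2)).1
  have h₂ := (Complex.le_def.1 (h.2.trace_mul_nonneg h'.1)).1
  simp only [Matrix.sub_mul, Matrix.mul_add, Matrix.add_mul, Matrix.mul_sub, Matrix.trace_add,
    Matrix.trace_sub, Complex.add_re, Complex.sub_re, Complex.zero_re] at h₁ h₂
  linarith

end LinearAlgebra

section TensorBip

variable {ι₁ κ₁ ι₂ κ₂ : Type*}

theorem tensorBip_one_one [DecidableEq ι₁] [DecidableEq κ₁] [DecidableEq ι₂] [DecidableEq κ₂] :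
    tensorBip (1 : Matrix (ι₁ × κ₁) (ι₁ × κ₁) ℂ) (1 : Matrix (ι₂ × κ₂) (ι₂ × κ₂) ℂ) = 1 := by
  ext x y
  simp only [tensorBip, Matrix.one_apply, Prod.ext_iff]
  split_ifs <;> simp_all

variable [Fintype ι₁] [Fintype κ₁] [Fintype ι₂] [Fintype κ₂]

theorem tensorBip_posSemidef {A : Matrix (ι₁ × κ₁) (ι₁ × κ₁) ℂ} {B : Matrix (ι₂ × κ₂) (ι₂ × κ₂) ℂ}
    (hA : A.PosSemidef) (hB : B.PosSemidef) : (tensorBip A B).PosSemidef :=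
  (hA.kronecker hB).submatrix (Equiv.prodProdProdComm ι₁ ι₂ κ₁ κ₂)

theorem trace_tensorBip (A : Matrix (ι₁ × κ₁) (ι₁ × κ₁) ℂ) (B : Matrix (ι₂ × κ₂) (ι₂ × κ₂) ℂ) :
    (tensorBip A B).trace = A.trace * B.trace := by
  rw [← Matrix.trace_kronecker]
  exact Fintype.sum_equiv (Equiv.prodProdProdComm ι₁ ι₂ κ₁ κ₂) _ _ fun _ => rfl

theorem tensorBip_mul (A A' : Matrix (ι₁ × κ₁) (ι₁ × κ₁) ℂ)
    (B B' : Matrix (ι₂ × κ₂) (ι₂ × κ₂) ℂ) :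
    tensorBip A B * tensorBip A' B' = tensorBip (A * A') (B * B') := by
  have h := Matrix.mul_kronecker_mul A A' B B'
  ext x y
  have := congrFun (congrFun h (Equiv.prodProdProdComm ι₁ ι₂ κ₁ κ₂ x))
    (Equiv.prodProdProdComm ι₁ ι₂ κ₁ κ₂ y)
  refine Eq.trans ?_ this.symm
  exact Fintype.sum_equiv (Equiv.prodProdProdComm ι₁ ι₂ κ₁ κ₂) _ _ fun _ => rfl

theorem Dominates.tensorBip {S A : Matrix (ι₁ × κ₁) (ι₁ × κ₁) ℂ}
    {T B : Matrix (ι₂ × κ₂) (ι₂ × κ₂) ℂ} (h : Dominates S A) (h' : Dominates T B) :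
    Dominates (tensorBip S T) (tensorBip A B) := by
  constructor
  · convert! ((tensorBip_posSemidef h.1 h'.2).add (tensorBip_posSemidef h.2 h'.1)).half_smul
      using 1
    ext x y
    simp only [_root_.tensorBip, Matrix.sub_apply, Matrix.add_apply, Matrix.smul_apply,
      smul_eq_mul]
    ring
  · convert! ((tensorBip_posSemidef h.1 h'.1).add (tensorBip_posSemidef h.2 h'.2)).half_smul
      using 1
    ext x y
    simp only [_root_.tensorBip, Matrix.sub_apply, Matrix.add_apply, Matrix.smul_apply,
      smul_eq_mul]
    ring

end TensorBip

section Ptrans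

variable {ι κ : Type*}

theorem ptrans_isHermitian {A : Matrix (ι × κ) (ι × κ) ℂ} (hA : A.IsHermitian) :
    (ptrans A).IsHermitian := by
  ext x y
  exact hA.apply (x.1, y.2) (y.1, x.2)

theorem ptrans_one [DecidableEq ι] [DecidableEq κ] :
    ptrans (1 : Matrix (ι × κ) (ι × κ) ℂ) = 1 := by
  ext x y
  simp only [ptrans, Matrix.one_apply, Prod.ext_iff]
  congr 1
  grind

variable [Fintype ι] [Fintype κ]

theorem trace_ptrans (A : Matrix (ι × κ) (ι × κ) ℂ) : (ptrans A).trace = A.trace := rfl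

theorem trace_ptrans_mul_ptrans (A B : Matrix (ι × κ) (ι × κ) ℂ) :
    (ptrans A * ptrans B).trace = (A * B).trace := by
  simp only [Matrix.trace, Matrix.diag, Matrix.mul_apply, ptrans, Fintype.sum_prod_type]
  refine Finset.sum_congr rfl fun i _ => ?_
  rw [Finset.sum_comm]
  conv_rhs => rw [Finset.sum_comm]
  refine Finset.sum_congr rfl fun j _ => ?_
  rw [Finset.sum_comm]

end Ptrans

section Powers

/-- `n`-fold Kronecker power of a matrix, indexed by functions on `Fin n`. -/
def kronPow {m : Type*} (M : Matrix m m ℂ) (n : ℕ) : Matrix (Fin n → m) (Fin n → m) ℂ :=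
  fun x y => ∏ i, M (x i) (y i)

theorem kronPow_conjTranspose {m : Type*} (M : Matrix m m ℂ) (n : ℕ) :
    (kronPow M n)ᴴ = kronPow Mᴴ n := by
  ext x y
  simp [kronPow, Matrix.conjTranspose_apply]

theorem kronPow_diagonal {m : Type*} [DecidableEq m] (d : m → ℂ) (n : ℕ) :
    kronPow (Matrix.diagonal d) n = Matrix.diagonal fun x => ∏ i, d (x i) := by
  ext x y
  by_cases h : x = y
  · simp [kronPow, h]
  · obtain ⟨i, hi⟩ := Function.ne_iff.1 h
    rw [Matrix.diagonal_apply_ne _ h]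
    exact Finset.prod_eq_zero (Finset.mem_univ i) (Matrix.diagonal_apply_ne _ hi)

variable {m : Type*} [Fintype m]

theorem kronPow_mul (M M' : Matrix m m ℂ) (n : ℕ) :
    kronPow (M * M') n = kronPow M n * kronPow M' n := by
  ext x y
  simp only [kronPow, Matrix.mul_apply, Fintype.prod_sum, Finset.prod_mul_distrib]

theorem trace_kronPow (M : Matrix m m ℂ) (n : ℕ) : (kronPow M n).trace = M.trace ^ n := by
  have h := Fintype.prod_sum fun (_ : Fin n) (j : m) => M j j
  rw [Finset.prod_const, Finset.card_univ, Fintype.card_fin] at h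
  exact h.symm

theorem kronPow_posSemidef {M : Matrix m m ℂ} (hM : M.PosSemidef) (n : ℕ) :
    (kronPow M n).PosSemidef := by
  obtain ⟨C, rfl⟩ := hM.exists_eq_conjTranspose_mul_self
  rw [kronPow_mul, ← kronPow_conjTranspose]
  exact Matrix.posSemidef_conjTranspose_mul_self _

theorem exists_dominates_kronPow [DecidableEq m] {A : Matrix m m ℂ} (hA : A.IsHermitian) (n : ℕ) :
    ∃ S, Dominates S (kronPow A n) ∧ S.trace = ((traceAbs A ^ n : ℝ) : ℂ) := by
  let U : Matrix m m ℂ := hA.eigenvectorUnitary.1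
  have hUU : Uᴴ * U = 1 := Unitary.coe_star_mul_self hA.eigenvectorUnitary
  have hAU : A = U * Matrix.diagonal (fun i => (hA.eigenvalues i : ℂ)) * Uᴴ := by
    conv_lhs => rw [hA.spectral_theorem]
    rfl
  let T : Matrix m m ℂ := U * Matrix.diagonal (fun i => ((|hA.eigenvalues i| : ℝ) : ℂ)) * Uᴴ
  have hT : T.trace = (traceAbs A : ℂ) := by
    rw [Matrix.trace_mul_comm, ← Matrix.mul_assoc, hUU, Matrix.one_mul, Matrix.trace_diagonal,
      traceAbs, dif_pos hA, Complex.ofReal_sum]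
  have hpow : ∀ d : m → ℂ, kronPow (U * Matrix.diagonal d * Uᴴ) n =
      kronPow U n * Matrix.diagonal (fun x => ∏ i, d (x i)) * (kronPow U n)ᴴ := by
    intro d
    rw [kronPow_mul, kronPow_mul, kronPow_diagonal, kronPow_conjTranspose]
  refine ⟨kronPow T n, ⟨?_, ?_⟩, by rw [trace_kronPow, hT, Complex.ofReal_pow]⟩
  · rw [hAU, hpow, hpow, ← Matrix.sub_mul, ← Matrix.mul_sub, Matrix.diagonal_sub]
    refine (Matrix.PosSemidef.diagonal fun x => ?_).mul_mul_conjTranspose_same _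
    rw [Pi.zero_apply, ← Complex.ofReal_prod, ← Complex.ofReal_prod, ← Complex.ofReal_sub,
      Complex.zero_le_real, sub_nonneg, ← Finset.abs_prod]
    exact le_abs_self _
  · rw [hAU, hpow, hpow, ← Matrix.add_mul, ← Matrix.mul_add, Matrix.diagonal_add]
    refine (Matrix.PosSemidef.diagonal fun x => ?_).mul_mul_conjTranspose_same _
    rw [Pi.zero_apply, ← Complex.ofReal_prod, ← Complex.ofReal_prod, ← Complex.ofReal_add,
      Complex.zero_le_real, ← Finset.abs_prod]
    linarith [neg_abs_le (∏ i, hA.eigenvalues (x i))]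

end Powers

section TensorPower

variable {ι κ : Type*}

theorem tpow_eq_submatrix (ρ : Matrix (ι × κ) (ι × κ) ℂ) (n : ℕ) :
    tpow ρ n = (kronPow ρ n).submatrix (fun x i => (x.1 i, x.2 i)) fun x i => (x.1 i, x.2 i) :=
  rfl

variable [Fintype ι] [Fintype κ]

theorem trace_submatrix_pair {n : ℕ}
    (M : Matrix (Fin n → ι × κ) (Fin n → ι × κ) ℂ) :
    (M.submatrix (fun (x : (Fin n → ι) × (Fin n → κ)) i => (x.1 i, x.2 i))
      fun x i => (x.1 i, x.2 i)).trace = M.trace :=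
  Fintype.sum_equiv (Equiv.arrowProdEquivProdArrow (Fin n) (fun _ => ι) (fun _ => κ)).symm _ _
    fun _ => rfl

theorem tpow_posSemidef {ρ : Matrix (ι × κ) (ι × κ) ℂ} (hρ : ρ.PosSemidef) (n : ℕ) :
    (tpow ρ n).PosSemidef :=
  (kronPow_posSemidef hρ n).submatrix _

theorem trace_tpow (ρ : Matrix (ι × κ) (ι × κ) ℂ) (n : ℕ) :
    (tpow ρ n).trace = ρ.trace ^ n := by
  rw [tpow_eq_submatrix, trace_submatrix_pair, trace_kronPow]

theorem exists_dominates_tpow [DecidableEq ι] [DecidableEq κ] {A : Matrix (ι × κ) (ι × κ) ℂ}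
    (hA : A.IsHermitian) (n : ℕ) :
    ∃ S, Dominates S (tpow A n) ∧ S.trace = ((traceAbs A ^ n : ℝ) : ℂ) := by
  obtain ⟨S, hS, hS'⟩ := exists_dominates_kronPow hA n
  exact ⟨_, hS.submatrix _, by rw [trace_submatrix_pair, hS']⟩

end TensorPower

section Fidelity

variable {ι κ : Type*} [Fintype ι] [Fintype κ] [DecidableEq ι] [DecidableEq κ]

/-- The tests `F` admissible in the definition of `FGamma _ K`. -/
def IsPPTTest (F : Matrix (ι × κ) (ι × κ) ℂ) (K : ℝ) : Prop :=
  F.PosSemidef ∧ (1 - F).PosSemidef ∧ Dominates (((1 / K : ℝ) : ℂ) • 1) (ptrans F)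

theorem scalar_posSemidef {m : Type*} [Fintype m] [DecidableEq m] {x : ℝ} (hx : 0 ≤ x) :
    ((x : ℂ) • (1 : Matrix m m ℂ)).PosSemidef :=
  Matrix.PosSemidef.one.smul (Complex.zero_le_real.2 hx)

theorem isPPTTest_zero {K : ℝ} (hK : 0 ≤ K) :
    IsPPTTest (0 : Matrix (ι × κ) (ι × κ) ℂ) K := by
  have h0 : ptrans (0 : Matrix (ι × κ) (ι × κ) ℂ) = 0 := rfl
  have hs := scalar_posSemidef (m := ι × κ) (one_div_nonneg.2 hK)
  refine ⟨.zero, by rw [sub_zero]; exact .one, ?_, ?_⟩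
  · rwa [h0, sub_zero]
  · rwa [h0, zero_add]

theorem IsPPTTest.mono {F : Matrix (ι × κ) (ι × κ) ℂ} {K L : ℝ} (hF : IsPPTTest F L)
    (hK : 0 < K) (hKL : K ≤ L) : IsPPTTest F K := by
  have hs := scalar_posSemidef (m := ι × κ)
    (sub_nonneg.2 (one_div_le_one_div_of_le hK hKL))
  refine ⟨hF.1, hF.2.1, ?_, ?_⟩
  · convert! hF.2.2.1.add hs using 1
    rw [Complex.ofReal_sub, sub_smul]
    abel
  · convert! hF.2.2.2.add hs using 1
    rw [Complex.ofReal_sub, sub_smul]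
    abel

theorem FGamma_le {ρ : Matrix (ι × κ) (ι × κ) ℂ} {K c : ℝ} (hK : 0 ≤ K)
    (h : ∀ F, IsPPTTest F K → ((F * ρ).trace).re ≤ c) : FGamma ρ K ≤ c := by
  refine csSup_le ?_ ?_
  · obtain ⟨h₁, h₂, h₃, h₄⟩ := isPPTTest_zero (ι := ι) (κ := κ) hK
    exact ⟨_, 0, h₁, h₂, h₃, h₄, rfl⟩
  · rintro x ⟨F, h₁, h₂, h₃, h₄, rfl⟩
    exact h F ⟨h₁, h₂, h₃, h₄⟩

theorem IsPPTTest.re_trace_le {ρ F : Matrix (ι × κ) (ι × κ) ℂ} {K : ℝ} (hρ : ρ.PosSemidef)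
    (hF : IsPPTTest F K) : ((F * ρ).trace).re ≤ ρ.trace.re := by
  have h := (Complex.le_def.1 (hF.2.1.trace_mul_nonneg hρ)).1
  rw [Matrix.sub_mul, Matrix.one_mul, Matrix.trace_sub, Complex.sub_re, Complex.zero_re] at h
  linarith

theorem IsPPTTest.le_FGamma {ρ F : Matrix (ι × κ) (ι × κ) ℂ} {K : ℝ} (hρ : ρ.PosSemidef)
    (hF : IsPPTTest F K) : ((F * ρ).trace).re ≤ FGamma ρ K := by
  refine le_csSup ⟨ρ.trace.re, ?_⟩ ⟨F, hF.1, hF.2.1, hF.2.2.1, hF.2.2.2, rfl⟩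
  rintro x ⟨F', h₁, h₂, h₃, h₄, rfl⟩
  exact IsPPTTest.re_trace_le (K := K) hρ ⟨h₁, h₂, h₃, h₄⟩

theorem FGamma_le_one {ρ : Matrix (ι × κ) (ι × κ) ℂ} {K : ℝ} (hρ : ρ.PosSemidef)
    (htr : ρ.trace = 1) (hK : 0 ≤ K) : FGamma ρ K ≤ 1 :=
  FGamma_le hK fun F hF => by simpa [htr] using hF.re_trace_le hρ

theorem FGamma_anti {ρ : Matrix (ι × κ) (ι × κ) ℂ} {K L : ℝ} (hρ : ρ.PosSemidef)
    (hK : 0 < K) (hKL : K ≤ L) : FGamma ρ L ≤ FGamma ρ K :=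
  FGamma_le (hK.le.trans hKL) fun _ hF => (hF.mono hK hKL).le_FGamma hρ

omit [Fintype ι] [Fintype κ] in
theorem isPPTTest_one : IsPPTTest (1 : Matrix (ι × κ) (ι × κ) ℂ) 1 := by
  refine ⟨.one, by rw [sub_self]; exact .zero, ?_, ?_⟩
  · rw [ptrans_one]
    simpa using Matrix.PosSemidef.zero
  · rw [ptrans_one]
    simpa using Matrix.PosSemidef.one.add Matrix.PosSemidef.one

/-- A test's fidelity is controlled by any operator dominating the partially transposed state. -/
theorem FGamma_le_trace_div {ρ S : Matrix (ι × κ) (ι × κ) ℂ} {K : ℝ} (hK : 0 ≤ K)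
    (hS : Dominates S (ptrans ρ)) : FGamma ρ K ≤ S.trace.re / K := by
  refine FGamma_le hK fun F hF => ?_
  have h := hF.2.2.re_trace_mul_le hS
  rw [trace_ptrans_mul_ptrans, Matrix.smul_mul, Matrix.one_mul, Matrix.trace_smul, smul_eq_mul,
    Complex.re_ofReal_mul] at h
  rwa [div_eq_mul_one_div, mul_comm]

variable {ι' κ' : Type*} [Fintype ι'] [Fintype κ'] [DecidableEq ι'] [DecidableEq κ']

omit [Fintype ι] [Fintype κ] [Fintype ι'] [Fintype κ'] in
theorem IsPPTTest.submatrix {F : Matrix (ι × κ) (ι × κ) ℂ} {K : ℝ} (hF : IsPPTTest F K)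
    (e : ι' ≃ ι) (f : κ' ≃ κ) :
    IsPPTTest (F.submatrix (e.prodCongr f) (e.prodCongr f)) K := by
  refine ⟨hF.1.submatrix _, ?_, ?_⟩
  · convert! hF.2.1.submatrix (e.prodCongr f) using 1
    rw [Matrix.submatrix_sub, Pi.sub_apply, Pi.sub_apply, Matrix.submatrix_one_equiv]
  · convert! hF.2.2.submatrix (e.prodCongr f) using 1
    rw [Matrix.submatrix_smul, Pi.smul_apply, Pi.smul_apply, Matrix.submatrix_one_equiv]

theorem FGamma_le_submatrix {ρ : Matrix (ι × κ) (ι × κ) ℂ} {K : ℝ} (hρ : ρ.PosSemidef)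
    (hK : 0 ≤ K) (e : ι' ≃ ι) (f : κ' ≃ κ) :
    FGamma ρ K ≤ FGamma (ρ.submatrix (e.prodCongr f) (e.prodCongr f)) K := by
  refine FGamma_le hK fun F hF => ?_
  have h := (hF.submatrix e f).le_FGamma (hρ.submatrix (e.prodCongr f))
  rw [Matrix.submatrix_mul_equiv] at h
  convert! h using 2
  exact (Fintype.sum_equiv (e.prodCongr f) _ _ fun _ => rfl).symm

theorem FGamma_submatrix {ρ : Matrix (ι × κ) (ι × κ) ℂ} {K : ℝ} (hρ : ρ.PosSemidef)
    (hK : 0 ≤ K) (e : ι' ≃ ι) (f : κ' ≃ κ) :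
    FGamma (ρ.submatrix (e.prodCongr f) (e.prodCongr f)) K = FGamma ρ K := by
  refine le_antisymm ?_ (FGamma_le_submatrix hρ hK e f)
  have h := FGamma_le_submatrix (hρ.submatrix (e.prodCongr f)) hK e.symm f.symm
  rw [Matrix.submatrix_submatrix] at h
  convert! h using 2
  ext x y
  simp [Prod.map_map]

end Fidelity

section FidelityTensor

variable {ι₁ κ₁ ι₂ κ₂ : Type*} [Fintype ι₁] [Fintype κ₁] [Fintype ι₂] [Fintype κ₂]
  [DecidableEq ι₁] [DecidableEq κ₁] [DecidableEq ι₂] [DecidableEq κ₂]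

theorem IsPPTTest.tensorBip {F : Matrix (ι₁ × κ₁) (ι₁ × κ₁) ℂ} {G : Matrix (ι₂ × κ₂) (ι₂ × κ₂) ℂ}
    {K L : ℝ} (hF : IsPPTTest F K) (hG : IsPPTTest G L) :
    IsPPTTest (tensorBip F G) (K * L) := by
  refine ⟨tensorBip_posSemidef hF.1 hG.1, ?_, ?_⟩
  · convert! (tensorBip_posSemidef hF.2.1 Matrix.PosSemidef.one).add
      (tensorBip_posSemidef hF.1 hG.2.1) using 1
    rw [← tensorBip_one_one]
    ext x y
    simp only [_root_.tensorBip, Matrix.sub_apply, Matrix.add_apply]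
    ring
  · convert! hF.2.2.tensorBip hG.2.2 using 1
    rw [← tensorBip_one_one]
    ext x y
    simp only [_root_.tensorBip, Matrix.smul_apply, smul_eq_mul]
    push_cast
    ring

theorem FGamma_tensorBip_ge {ρ₁ : Matrix (ι₁ × κ₁) (ι₁ × κ₁) ℂ}
    {ρ₂ : Matrix (ι₂ × κ₂) (ι₂ × κ₂) ℂ} (hρ₁ : ρ₁.PosSemidef) (hρ₂ : ρ₂.PosSemidef)
    (htr₁ : ρ₁.trace = 1) (htr₂ : ρ₂.trace = 1) {K L : ℝ} (hK : 0 ≤ K) (hL : 0 ≤ L) :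
    FGamma ρ₁ K + FGamma ρ₂ L - 1 ≤ FGamma (tensorBip ρ₁ ρ₂) (K * L) := by
  suffices h : FGamma ρ₁ K ≤ FGamma (tensorBip ρ₁ ρ₂) (K * L) + 1 - FGamma ρ₂ L by linarith
  refine FGamma_le hK fun F hF => ?_
  suffices h : FGamma ρ₂ L ≤ FGamma (tensorBip ρ₁ ρ₂) (K * L) + 1 - ((F * ρ₁).trace).re by linarith
  refine FGamma_le hL fun G hG => ?_
  have h := (hF.tensorBip hG).le_FGamma (tensorBip_posSemidef hρ₁ hρ₂)
  have him := (Complex.le_def.1 (hF.1.trace_mul_nonneg hρ₁)).2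
  have h₁ := hF.re_trace_le hρ₁
  have h₂ := hG.re_trace_le hρ₂
  rw [tensorBip_mul, trace_tensorBip, Complex.mul_re, ← him] at h
  rw [htr₁, Complex.one_re] at h₁
  rw [htr₂, Complex.one_re] at h₂
  simp only [Complex.zero_im, zero_mul, sub_zero] at h
  nlinarith [mul_nonneg (sub_nonneg.2 h₁) (sub_nonneg.2 h₂)]

/-- Partial trace of `F * (1 ⊗ ρ)` over the second bipartite system. -/
def sliceBip (F : Matrix ((ι₁ × ι₂) × (κ₁ × κ₂)) ((ι₁ × ι₂) × (κ₁ × κ₂)) ℂ)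
    (ρ : Matrix (ι₂ × κ₂) (ι₂ × κ₂) ℂ) : Matrix (ι₁ × κ₁) (ι₁ × κ₁) ℂ :=
  sliceTrace (F.submatrix (Equiv.prodProdProdComm ι₁ κ₁ ι₂ κ₂)
    (Equiv.prodProdProdComm ι₁ κ₁ ι₂ κ₂)) ρ

omit [DecidableEq ι₁] [DecidableEq κ₁] [DecidableEq ι₂] [DecidableEq κ₂] in
theorem trace_sliceBip_mul (F : Matrix ((ι₁ × ι₂) × (κ₁ × κ₂)) ((ι₁ × ι₂) × (κ₁ × κ₂)) ℂ)
    (ρ₁ : Matrix (ι₁ × κ₁) (ι₁ × κ₁) ℂ) (ρ₂ : Matrix (ι₂ × κ₂) (ι₂ × κ₂) ℂ) :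
    (sliceBip F ρ₂ * ρ₁).trace = (F * tensorBip ρ₁ ρ₂).trace := by
  have h : (F * tensorBip ρ₁ ρ₂).trace = ∑ x : (ι₁ × κ₁) × (ι₂ × κ₂), ∑ y : (ι₁ × κ₁) × (ι₂ × κ₂),
      F (Equiv.prodProdProdComm ι₁ κ₁ ι₂ κ₂ x) (Equiv.prodProdProdComm ι₁ κ₁ ι₂ κ₂ y) *
        (ρ₁ y.1 x.1 * ρ₂ y.2 x.2) :=
    ((Equiv.prodProdProdComm ι₁ κ₁ ι₂ κ₂).sum_comp _).symm.trans <|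
      Finset.sum_congr rfl fun _ _ => ((Equiv.prodProdProdComm ι₁ κ₁ ι₂ κ₂).sum_comp _).symm
  rw [h, Fintype.sum_prod_type]
  simp only [Matrix.trace, Matrix.diag, Matrix.mul_apply, sliceBip, sliceTrace,
    Matrix.submatrix_apply, Finset.sum_mul]
  refine Finset.sum_congr rfl fun x _ => ?_
  rw [Finset.sum_comm]
  refine Finset.sum_congr rfl fun u _ => ?_
  refine Eq.trans ?_ (Fintype.sum_prod_type _).symm
  exact Finset.sum_congr rfl fun y _ => Finset.sum_congr rfl fun v _ => by ring

omit [Fintype ι₁] [Fintype κ₁] [DecidableEq ι₁] [DecidableEq κ₁] [DecidableEq ι₂]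
  [DecidableEq κ₂] in
theorem ptrans_sliceBip (F : Matrix ((ι₁ × ι₂) × (κ₁ × κ₂)) ((ι₁ × ι₂) × (κ₁ × κ₂)) ℂ)
    (ρ : Matrix (ι₂ × κ₂) (ι₂ × κ₂) ℂ) :
    ptrans (sliceBip F ρ) = sliceBip (ptrans F) (ptrans ρ) := by
  ext x y
  simp only [ptrans, sliceBip, sliceTrace, Matrix.submatrix_apply, Fintype.sum_prod_type,
    Equiv.prodProdProdComm_apply]
  refine Finset.sum_congr rfl fun k _ => ?_
  rw [Finset.sum_comm]
  conv_rhs => rw [Finset.sum_comm]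
  refine Finset.sum_congr rfl fun k' _ => ?_
  rw [Finset.sum_comm]

omit [Fintype ι₁] [Fintype κ₁] in
theorem sliceBip_smul_one (c : ℂ) (ρ : Matrix (ι₂ × κ₂) (ι₂ × κ₂) ℂ) :
    sliceBip (c • (1 : Matrix ((ι₁ × ι₂) × (κ₁ × κ₂)) ((ι₁ × ι₂) × (κ₁ × κ₂)) ℂ)) ρ =
      (c * ρ.trace) • 1 := by
  ext x y
  simp only [sliceBip, Matrix.submatrix_smul, Pi.smul_apply, Matrix.submatrix_one_equiv,
    sliceTrace, Matrix.smul_apply, smul_eq_mul, Matrix.one_apply, Prod.mk.injEq]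
  by_cases h : x = y
  · simp [h, Matrix.trace, Finset.mul_sum]
  · simp [h]

omit [DecidableEq ι₁] [DecidableEq κ₁] [DecidableEq ι₂] [DecidableEq κ₂] in
theorem Dominates.sliceBip
    {S A : Matrix ((ι₁ × ι₂) × (κ₁ × κ₂)) ((ι₁ × ι₂) × (κ₁ × κ₂)) ℂ}
    {T B : Matrix (ι₂ × κ₂) (ι₂ × κ₂) ℂ} (h : Dominates S A) (h' : Dominates T B) :
    Dominates (sliceBip S T) (sliceBip A B) :=
  (h.submatrix _).sliceTrace h'

theorem IsPPTTest.sliceBip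
    {F : Matrix ((ι₁ × ι₂) × (κ₁ × κ₂)) ((ι₁ × ι₂) × (κ₁ × κ₂)) ℂ} {K N : ℝ}
    (hF : IsPPTTest F K) {ρ S : Matrix (ι₂ × κ₂) (ι₂ × κ₂) ℂ} (hρ : ρ.PosSemidef)
    (htr : ρ.trace = 1) (hS : Dominates S (ptrans ρ)) (hN : S.trace = (N : ℂ)) :
    IsPPTTest (sliceBip F ρ) (K / N) := by
  refine ⟨sliceTrace_posSemidef (hF.1.submatrix _) hρ, ?_, ?_⟩
  · convert! sliceTrace_posSemidef (hF.2.1.submatrix (Equiv.prodProdProdComm ι₁ κ₁ ι₂ κ₂)) hρ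
      using 1
    have h := sliceBip_smul_one (ι₁ := ι₁) (κ₁ := κ₁) 1 ρ
    rw [htr, one_mul, one_smul, one_smul] at h
    rw [← h]
    ext x y
    simp only [_root_.sliceBip, sliceTrace, Matrix.sub_apply, Matrix.submatrix_apply, sub_mul,
      Finset.sum_sub_distrib]
  · have h := hF.2.2.sliceBip hS
    rw [sliceBip_smul_one, hN, ← ptrans_sliceBip] at h
    convert! h using 2
    rw [← Complex.ofReal_mul, one_div_div, div_mul_eq_mul_div, one_mul]

theorem FGamma_tensorBip_le {ρ₁ : Matrix (ι₁ × κ₁) (ι₁ × κ₁) ℂ}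
    {ρ₂ S : Matrix (ι₂ × κ₂) (ι₂ × κ₂) ℂ} (hρ₁ : ρ₁.PosSemidef) (hρ₂ : ρ₂.PosSemidef)
    (htr₂ : ρ₂.trace = 1) {K N : ℝ} (hK : 0 ≤ K) (hS : Dominates S (ptrans ρ₂))
    (hN : S.trace = (N : ℂ)) :
    FGamma (tensorBip ρ₁ ρ₂) K ≤ FGamma ρ₁ (K / N) := by
  refine FGamma_le hK fun F hF => ?_
  rw [← trace_sliceBip_mul]
  exact (hF.sliceBip hρ₂ htr₂ hS hN).le_FGamma hρ₁

end FidelityTensor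

section TraceAbs

variable {m : Type*} [Fintype m] [DecidableEq m]

theorem sum_eigenvalues_eq_one {A : Matrix m m ℂ} (hA : A.IsHermitian) (htr : A.trace = 1) :
    ∑ i, hA.eigenvalues i = 1 := by
  have h := congrArg Complex.re hA.trace_eq_sum_eigenvalues
  rw [htr] at h
  simpa using h.symm

theorem one_le_traceAbs {A : Matrix m m ℂ} (hA : A.IsHermitian) (htr : A.trace = 1) :
    1 ≤ traceAbs A := by
  rw [traceAbs, dif_pos hA, ← sum_eigenvalues_eq_one hA htr]
  exact Finset.sum_le_sum fun i _ => le_abs_self _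

theorem traceAbs_eq_one {A : Matrix m m ℂ} (hA : A.PosSemidef) (htr : A.trace = 1) :
    traceAbs A = 1 := by
  rw [traceAbs, dif_pos hA.1, ← sum_eigenvalues_eq_one hA.1 htr]
  exact Finset.sum_congr rfl fun i _ => abs_of_nonneg (hA.eigenvalues_nonneg i)

theorem traceAbs_of_mul_self {A : Matrix m m ℂ} (hA : A.IsHermitian) {x : ℝ} (hx : 0 ≤ x)
    (h : A * A = ((x ^ 2 : ℝ) : ℂ) • 1) : traceAbs A = Fintype.card m * x := by
  have key : ∀ i, |hA.eigenvalues i| = x := by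
    intro i
    have h₁ := hA.mulVec_eigenvectorBasis i
    set v : m → ℂ := ⇑(hA.eigenvectorBasis i) with hv
    have h₂ : (A * A) *ᵥ v = ((hA.eigenvalues i ^ 2 : ℝ) : ℂ) • v := by
      rw [← Matrix.mulVec_mulVec, h₁, Matrix.mulVec_smul, h₁, smul_smul, ← sq]
      ext j
      simp
    rw [h, Matrix.smul_mulVec, Matrix.one_mulVec] at h₂
    have hv0 : v ≠ 0 := fun h0 => hA.eigenvectorBasis.toBasis.ne_zero i (by
      rw [OrthonormalBasis.coe_toBasis]
      ext j
      exact congrFun h0 j)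
    have h₃ := smul_left_injective ℂ hv0 h₂
    have h₄ : x ^ 2 = hA.eigenvalues i ^ 2 := by exact_mod_cast h₃
    rw [← abs_of_nonneg hx]
    exact (sq_eq_sq_iff_abs_eq_abs _ _).1 h₄.symm
  rw [traceAbs, dif_pos hA, Finset.sum_congr rfl fun i _ => key i, Finset.sum_const,
    Finset.card_univ, nsmul_eq_mul]

end TraceAbs

section Rates

theorem half_le_floor {x : ℝ} (hx : 1 ≤ x) : x / 2 ≤ (⌊x⌋ : ℤ) := by
  have h₁ : (1 : ℝ) ≤ (⌊x⌋ : ℤ) := by exact_mod_cast Int.le_floor.2 (by simpa using hx)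
  linarith [Int.lt_floor_add_one x]

theorem half_rpow_le_floor {r : ℝ} (hr : 0 ≤ r) (n : ℕ) :
    (2 : ℝ) ^ (r * (n : ℝ)) / 2 ≤ (⌊(2 : ℝ) ^ (r * (n : ℝ))⌋ : ℤ) :=
  half_le_floor (Real.one_le_rpow one_le_two (by positivity))

theorem floor_rpow_pos {r : ℝ} (hr : 0 ≤ r) (n : ℕ) :
    (0 : ℝ) < (⌊(2 : ℝ) ^ (r * (n : ℝ))⌋ : ℤ) :=
  lt_of_lt_of_le (by positivity) (half_rpow_le_floor hr n)

variable {ι κ : Type*} [Fintype ι] [Fintype κ] [DecidableEq ι] [DecidableEq κ]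

/-- `r` is an achievable rate of p.p.t. distillation. -/
def IsRate (ρ : Matrix (ι × κ) (ι × κ) ℂ) (r : ℝ) : Prop :=
  0 ≤ r ∧ Tendsto (fun n : ℕ => FGamma (tpow ρ n) ((⌊(2 : ℝ) ^ (r * (n : ℝ))⌋ : ℤ) : ℝ))
    atTop (nhds 1)

theorem DGamma_nonneg (ρ : Matrix (ι × κ) (ι × κ) ℂ) : 0 ≤ DGamma ρ :=
  Real.sSup_nonneg fun _ hr => hr.1

omit [DecidableEq ι] [DecidableEq κ] in
theorem trace_tpow_eq_one {ρ : Matrix (ι × κ) (ι × κ) ℂ} (htr : ρ.trace = 1) (n : ℕ) :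
    (tpow ρ n).trace = 1 := by
  rw [trace_tpow, htr, one_pow]

theorem isRate_zero {ρ : Matrix (ι × κ) (ι × κ) ℂ} (hρ : ρ.PosSemidef) (htr : ρ.trace = 1) :
    IsRate ρ 0 := by
  refine ⟨le_rfl, tendsto_const_nhds.congr fun n => ?_⟩
  simp only [zero_mul, Real.rpow_zero, Int.floor_one, Int.cast_one]
  refine le_antisymm ?_ (FGamma_le_one (tpow_posSemidef hρ n) (trace_tpow_eq_one htr n) zero_le_one)
  simpa [trace_tpow_eq_one htr] using isPPTTest_one.le_FGamma (tpow_posSemidef hρ n)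

theorem IsRate.le_logb {ρ : Matrix (ι × κ) (ι × κ) ℂ} (hρ : ρ.PosSemidef) (htr : ρ.trace = 1)
    {r : ℝ} (hr : IsRate ρ r) : r ≤ Real.logb 2 (traceAbs (ptrans ρ)) := by
  have hH := ptrans_isHermitian hρ.1
  set N := traceAbs (ptrans ρ) with hN
  have hN0 : 0 < N := lt_of_lt_of_le one_pos (one_le_traceAbs hH (by rw [trace_ptrans, htr]))
  by_contra! hlt
  have hNr : N < 2 ^ r := (Real.logb_lt_iff_lt_rpow one_lt_two hN0).1 hlt
  have h2r : (0 : ℝ) < 2 ^ r := by positivity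
  have hlim : Tendsto (fun n : ℕ => 2 * (N / 2 ^ r) ^ n) atTop (nhds (2 * 0)) :=
    (tendsto_pow_atTop_nhds_zero_of_lt_one (by positivity) ((div_lt_one h2r).2 hNr)).const_mul 2
  have hle := le_of_tendsto_of_tendsto' hr.2 hlim fun n => by
    obtain ⟨S, hS, hS'⟩ := exists_dominates_tpow hH n
    refine (FGamma_le_trace_div (floor_rpow_pos hr.1 n).le hS).trans ?_
    rw [hS', Complex.ofReal_re, ← hN]
    refine (div_le_div_of_nonneg_left (by positivity) (by positivity)
      (half_rpow_le_floor hr.1 n)).trans (le_of_eq ?_)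
    rw [Real.rpow_mul zero_le_two, Real.rpow_natCast, div_pow]
    field_simp
  norm_num at hle

theorem IsRate.le_DGamma {ρ : Matrix (ι × κ) (ι × κ) ℂ} (hρ : ρ.PosSemidef) (htr : ρ.trace = 1)
    {r : ℝ} (hr : IsRate ρ r) : r ≤ DGamma ρ :=
  le_csSup ⟨_, fun _ hs => IsRate.le_logb hρ htr hs⟩ hr

theorem DGamma_le {ρ : Matrix (ι × κ) (ι × κ) ℂ} (hρ : ρ.PosSemidef) (htr : ρ.trace = 1)
    {x : ℝ} (h : ∀ r, IsRate ρ r → r ≤ x) : DGamma ρ ≤ x :=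
  csSup_le ⟨0, isRate_zero hρ htr⟩ h

theorem le_DGamma_of_tendsto {ρ : Matrix (ι × κ) (ι × κ) ℂ} (hρ : ρ.PosSemidef)
    (htr : ρ.trace = 1) {R c : ℝ} (hc : 0 < c) {K : ℕ → ℝ}
    (hK : ∀ n : ℕ, c * 2 ^ (R * (n : ℝ)) ≤ K n)
    (hlim : Tendsto (fun n => FGamma (tpow ρ n) (K n)) atTop (nhds 1)) : R ≤ DGamma ρ := by
  refine le_of_forall_lt fun s hs => ?_
  obtain ⟨r, hsr, hrR⟩ := exists_between hs
  refine hsr.trans_le ?_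
  rcases lt_or_ge r 0 with hr | hr
  · exact hr.le.trans (DGamma_nonneg ρ)
  refine IsRate.le_DGamma hρ htr ⟨hr, tendsto_of_tendsto_of_tendsto_of_le_of_le' hlim
    tendsto_const_nhds ?_ (.of_forall fun n => FGamma_le_one (tpow_posSemidef hρ n)
      (trace_tpow_eq_one htr n) (floor_rpow_pos hr n).le)⟩
  have hbig : Tendsto (fun n : ℕ => ((2 : ℝ) ^ (R - r)) ^ n) atTop atTop :=
    tendsto_pow_atTop_atTop_of_one_lt (Real.one_lt_rpow one_lt_two (sub_pos.2 hrR))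
  filter_upwards [hbig.eventually_ge_atTop (1 / c)] with n hn
  refine FGamma_anti (tpow_posSemidef hρ n) (floor_rpow_pos hr n) ?_
  refine (Int.floor_le _).trans (le_trans ?_ (hK n))
  rw [div_le_iff₀ hc, ← Real.rpow_natCast, ← Real.rpow_mul zero_le_two] at hn
  have hsplit : (2 : ℝ) ^ (R * (n : ℝ)) = 2 ^ ((R - r) * (n : ℝ)) * 2 ^ (r * (n : ℝ)) := by
    rw [← Real.rpow_add two_pos]
    ring_nf
  have hp : (0 : ℝ) < 2 ^ (r * (n : ℝ)) := by positivity
  rw [hsplit]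
  nlinarith

end Rates

section TensorRates

variable {ι₁ κ₁ ι₂ κ₂ : Type*}

theorem tpow_tensorBip (A : Matrix (ι₁ × κ₁) (ι₁ × κ₁) ℂ) (B : Matrix (ι₂ × κ₂) (ι₂ × κ₂) ℂ)
    (n : ℕ) :
    tpow (tensorBip A B) n = (tensorBip (tpow A n) (tpow B n)).submatrix
      ((Equiv.arrowProdEquivProdArrow (Fin n) (fun _ => ι₁) fun _ => ι₂).prodCongr
        (Equiv.arrowProdEquivProdArrow (Fin n) (fun _ => κ₁) fun _ => κ₂))
      ((Equiv.arrowProdEquivProdArrow (Fin n) (fun _ => ι₁) fun _ => ι₂).prodCongr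
        (Equiv.arrowProdEquivProdArrow (Fin n) (fun _ => κ₁) fun _ => κ₂)) := by
  ext x y
  exact Finset.prod_mul_distrib

variable [Fintype ι₁] [Fintype κ₁] [Fintype ι₂] [Fintype κ₂]
  [DecidableEq ι₁] [DecidableEq κ₁] [DecidableEq ι₂] [DecidableEq κ₂]
  {ρ₁ : Matrix (ι₁ × κ₁) (ι₁ × κ₁) ℂ} {ρ₂ : Matrix (ι₂ × κ₂) (ι₂ × κ₂) ℂ}

theorem FGamma_tpow_tensorBip (hρ₁ : ρ₁.PosSemidef) (hρ₂ : ρ₂.PosSemidef) (n : ℕ) {K : ℝ}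
    (hK : 0 ≤ K) :
    FGamma (tpow (tensorBip ρ₁ ρ₂) n) K = FGamma (tensorBip (tpow ρ₁ n) (tpow ρ₂ n)) K := by
  rw [tpow_tensorBip]
  exact FGamma_submatrix (tensorBip_posSemidef (tpow_posSemidef hρ₁ n) (tpow_posSemidef hρ₂ n))
    hK _ _

theorem DGamma_add_le (hρ₁ : ρ₁.PosSemidef) (htr₁ : ρ₁.trace = 1) (hρ₂ : ρ₂.PosSemidef)
    (htr₂ : ρ₂.trace = 1) : DGamma ρ₁ + DGamma ρ₂ ≤ DGamma (tensorBip ρ₁ ρ₂) := by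
  suffices h : ∀ r, IsRate ρ₁ r → ∀ s, IsRate ρ₂ s → r + s ≤ DGamma (tensorBip ρ₁ ρ₂) by
    refine le_sub_iff_add_le.1 (DGamma_le hρ₁ htr₁ fun r hr => ?_)
    refine le_sub_comm.1 (DGamma_le hρ₂ htr₂ fun s hs => ?_)
    linarith [h r hr s hs]
  intro r hr s hs
  refine le_DGamma_of_tendsto (tensorBip_posSemidef hρ₁ hρ₂)
    (by rw [trace_tensorBip, htr₁, htr₂, one_mul]) (c := 1 / 4) (by norm_num)
    (K := fun n => ((⌊(2 : ℝ) ^ (r * (n : ℝ))⌋ : ℤ) : ℝ) * ((⌊(2 : ℝ) ^ (s * (n : ℝ))⌋ : ℤ) : ℝ))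
    (fun n => ?_) ?_
  · refine le_trans (le_of_eq ?_) (mul_le_mul (half_rpow_le_floor hr.1 n)
      (half_rpow_le_floor hs.1 n) (by positivity) (floor_rpow_pos hr.1 n).le)
    rw [add_mul, Real.rpow_add two_pos]
    ring
  · have hlim : Tendsto _ atTop (nhds (1 + 1 - 1 : ℝ)) := (hr.2.add hs.2).sub_const 1
    rw [add_sub_cancel_right] at hlim
    have hK : ∀ n : ℕ, (0 : ℝ) ≤ ((⌊(2 : ℝ) ^ (r * (n : ℝ))⌋ : ℤ) : ℝ) *
        ((⌊(2 : ℝ) ^ (s * (n : ℝ))⌋ : ℤ) : ℝ) := fun n =>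
      mul_nonneg (floor_rpow_pos hr.1 n).le (floor_rpow_pos hs.1 n).le
    refine tendsto_of_tendsto_of_tendsto_of_le_of_le hlim tendsto_const_nhds (fun n => ?_)
      fun n => ?_
    · rw [FGamma_tpow_tensorBip hρ₁ hρ₂ n (hK n)]
      exact FGamma_tensorBip_ge (tpow_posSemidef hρ₁ n) (tpow_posSemidef hρ₂ n)
        (trace_tpow_eq_one htr₁ n) (trace_tpow_eq_one htr₂ n) (floor_rpow_pos hr.1 n).le
        (floor_rpow_pos hs.1 n).le
    · exact FGamma_le_one (tpow_posSemidef (tensorBip_posSemidef hρ₁ hρ₂) n)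
        (trace_tpow_eq_one (by rw [trace_tensorBip, htr₁, htr₂, one_mul]) n) (hK n)

theorem DGamma_tensorBip_le (hρ₁ : ρ₁.PosSemidef) (htr₁ : ρ₁.trace = 1) (hρ₂ : ρ₂.PosSemidef)
    (htr₂ : ρ₂.trace = 1) :
    DGamma (tensorBip ρ₁ ρ₂) ≤ DGamma ρ₁ + Real.logb 2 (traceAbs (ptrans ρ₂)) := by
  have hH := ptrans_isHermitian hρ₂.1
  set N := traceAbs (ptrans ρ₂) with hN
  have hN0 : 0 < N := lt_of_lt_of_le one_pos (one_le_traceAbs hH (by rw [trace_ptrans, htr₂]))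
  refine DGamma_le (tensorBip_posSemidef hρ₁ hρ₂)
    (by rw [trace_tensorBip, htr₁, htr₂, one_mul]) fun r hr => ?_
  rw [← sub_le_iff_le_add]
  refine le_DGamma_of_tendsto hρ₁ htr₁ (c := 1 / 2) (by norm_num)
    (K := fun n => ((⌊(2 : ℝ) ^ (r * (n : ℝ))⌋ : ℤ) : ℝ) / N ^ n) (fun n => ?_) ?_
  · rw [le_div_iff₀ (by positivity)]
    refine le_trans (le_of_eq ?_) (half_rpow_le_floor hr.1 n)
    have hNn : (2 : ℝ) ^ (Real.logb 2 N * (n : ℝ)) = N ^ n := by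
      rw [Real.rpow_mul zero_le_two, Real.rpow_logb two_pos (by norm_num) hN0, Real.rpow_natCast]
    rw [sub_mul, Real.rpow_sub two_pos, hNn]
    field_simp
  · refine tendsto_of_tendsto_of_tendsto_of_le_of_le hr.2 tendsto_const_nhds (fun n => ?_)
      fun n => ?_
    · obtain ⟨S, hS, hS'⟩ := exists_dominates_tpow hH n
      dsimp only
      rw [FGamma_tpow_tensorBip hρ₁ hρ₂ n (floor_rpow_pos hr.1 n).le]
      exact FGamma_tensorBip_le (tpow_posSemidef hρ₁ n) (tpow_posSemidef hρ₂ n)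
        (trace_tpow_eq_one htr₂ n) (floor_rpow_pos hr.1 n).le hS hS'
    · exact FGamma_le_one (tpow_posSemidef hρ₁ n) (trace_tpow_eq_one htr₁ n)
        (div_nonneg (floor_rpow_pos hr.1 n).le (by positivity))

end TensorRates

section MaxEntangled

/-- The maximally entangled state on an arbitrary finite index type. -/
def maxEntOn (ι : Type*) [Fintype ι] [DecidableEq ι] : Matrix (ι × ι) (ι × ι) ℂ :=
  fun x y => if x.1 = x.2 ∧ y.1 = y.2 then (1 / (Fintype.card ι : ℂ)) else 0

theorem maxEnt_eq (d : ℕ) : maxEnt d = maxEntOn (Fin d) := by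
  ext x y
  simp [maxEnt, maxEntOn]

theorem tpow_maxEnt (d n : ℕ) : tpow (maxEnt d) n = maxEntOn (Fin n → Fin d) := by
  ext x y
  simp only [tpow, maxEnt, maxEntOn, Finset.prod_ite_zero, Finset.mem_univ, forall_const,
    funext_iff, forall_and, Finset.prod_const, Finset.card_univ, Fintype.card_pi, Fintype.card_fin]
  simp

variable {ι : Type*} [Fintype ι] [DecidableEq ι]

theorem maxEntOn_isHermitian : (maxEntOn ι).IsHermitian := by
  ext x y
  simp only [maxEntOn, Matrix.conjTranspose_apply, and_comm (a := y.1 = y.2)]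
  split_ifs <;> simp

theorem trace_maxEntOn [Nonempty ι] : (maxEntOn ι).trace = 1 := by
  simp [Matrix.trace, maxEntOn, Fintype.sum_prod_type]

theorem maxEntOn_mul_self [Nonempty ι] : maxEntOn ι * maxEntOn ι = maxEntOn ι := by
  ext x y
  by_cases hx : x.1 = x.2 <;> by_cases hy : y.1 = y.2 <;>
    simp [Matrix.mul_apply, maxEntOn, Fintype.sum_prod_type, hx, hy]

theorem ptrans_maxEntOn_mul_self :
    ptrans (maxEntOn ι) * ptrans (maxEntOn ι) =
      (((1 / (Fintype.card ι : ℝ)) ^ 2 : ℝ) : ℂ) • 1 := by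
  ext x y
  have h : ∀ z : ι × ι, ptrans (maxEntOn ι) x z * ptrans (maxEntOn ι) z y =
      if z = (x.2, x.1) then (if x = y then (1 / (Fintype.card ι : ℂ)) ^ 2 else 0) else 0 := by
    intro z
    simp only [ptrans, maxEntOn, Prod.ext_iff]
    split_ifs <;> grind
  rw [Matrix.mul_apply, Finset.sum_congr rfl fun z _ => h z, Finset.sum_ite_eq' Finset.univ]
  simp [Matrix.one_apply]

theorem isPPTTest_maxEntOn [Nonempty ι] : IsPPTTest (maxEntOn ι) (Fintype.card ι) := by
  have hH := maxEntOn_isHermitian (ι := ι)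
  have hidem : ∀ A : Matrix (ι × ι) (ι × ι) ℂ, A.IsHermitian →
      A * A = (((1 / (Fintype.card ι : ℝ)) ^ 2 : ℝ) : ℂ) • 1 →
      (A + ((1 / (Fintype.card ι : ℝ) : ℝ) : ℂ) • 1).PosSemidef := by
    intro A hA hAA
    have hB : (A + ((1 / (Fintype.card ι : ℝ) : ℝ) : ℂ) • 1).IsHermitian :=
      hA.add (scalar_posSemidef (by positivity)).1
    convert! (Matrix.posSemidef_conjTranspose_mul_self
      (A + ((1 / (Fintype.card ι : ℝ) : ℝ) : ℂ) • 1)).smul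
        (Complex.zero_le_real.2 (show (0 : ℝ) ≤ Fintype.card ι / 2 by positivity)) using 1
    rw [hB.eq, Matrix.add_mul, Matrix.mul_add, Matrix.mul_add, hAA]
    ext x y
    simp only [Matrix.smul_mul, Matrix.mul_smul, Matrix.one_mul, Matrix.mul_one,
      Matrix.add_apply, Matrix.smul_apply, smul_eq_mul]
    push_cast
    field_simp
    ring
  refine ⟨posSemidef_of_mul_self_eq hH maxEntOn_mul_self,
    posSemidef_of_mul_self_eq (Matrix.isHermitian_one.sub hH) ?_, ?_, ?_⟩
  · simp [Matrix.sub_mul, Matrix.mul_sub, maxEntOn_mul_self]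
  · rw [sub_eq_neg_add]
    exact hidem _ (ptrans_isHermitian hH).neg (by rw [neg_mul_neg, ptrans_maxEntOn_mul_self])
  · exact hidem _ (ptrans_isHermitian hH) ptrans_maxEntOn_mul_self

theorem maxEntOn_posSemidef [Nonempty ι] : (maxEntOn ι).PosSemidef :=
  isPPTTest_maxEntOn.1

theorem traceAbs_ptrans_maxEntOn [Nonempty ι] :
    traceAbs (ptrans (maxEntOn ι)) = Fintype.card ι := by
  rw [traceAbs_of_mul_self (ptrans_isHermitian maxEntOn_isHermitian) (by positivity)
    ptrans_maxEntOn_mul_self, Fintype.card_prod]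
  push_cast
  field_simp

theorem logb_le_DGamma_maxEnt {d : ℕ} (hd : 1 ≤ d) : Real.logb 2 (d : ℝ) ≤ DGamma (maxEnt d) := by
  have : NeZero d := ⟨by omega⟩
  have hpos : (maxEnt d).PosSemidef := maxEnt_eq d ▸ maxEntOn_posSemidef
  have htr : (maxEnt d).trace = 1 := maxEnt_eq d ▸ trace_maxEntOn
  have hd0 : (0 : ℝ) < d := by exact_mod_cast hd
  refine le_DGamma_of_tendsto hpos htr one_pos (K := fun n => (d : ℝ) ^ n) (fun n => ?_) ?_
  · rw [one_mul, Real.rpow_mul zero_le_two, Real.rpow_logb two_pos (by norm_num) hd0,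
      Real.rpow_natCast]
  · refine tendsto_const_nhds.congr fun n => ?_
    refine le_antisymm ?_ (FGamma_le_one (tpow_posSemidef hpos n) (trace_tpow_eq_one htr n)
      (by positivity))
    have h := (isPPTTest_maxEntOn (ι := Fin n → Fin d)).le_FGamma maxEntOn_posSemidef
    rw [maxEntOn_mul_self, trace_maxEntOn, Complex.one_re] at h
    rw [tpow_maxEnt]
    simpa using h

end MaxEntangled

/-- Asymptotic tensor product bounds for p.p.t. distillable entanglement:
`D_Γ(ρ₁) + D_Γ(ρ₂) ≤ D_Γ(ρ₁⊗ρ₂) ≤ D_Γ(ρ₁) + log₂ Tr|ρ₂^Γ|`; in particular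
`D_Γ(ρ₁ ⊗ Φ(d)) = D_Γ(ρ₁) + log₂ d`, and `D_Γ(ρ₁ ⊗ ρ₂) = D_Γ(ρ₁)` when `ρ₂` is p.p.t. -/
theorem DGamma_tensor_bounds {a b c e : ℕ}
    (ρ₁ : Matrix (Fin a × Fin b) (Fin a × Fin b) ℂ)
    (ρ₂ : Matrix (Fin c × Fin e) (Fin c × Fin e) ℂ)
    (hρ₁ : ρ₁.PosSemidef) (hρ₁tr : ρ₁.trace = 1)
    (hρ₂ : ρ₂.PosSemidef) (hρ₂tr : ρ₂.trace = 1) :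
    (DGamma ρ₁ + DGamma ρ₂ ≤ DGamma (tensorBip ρ₁ ρ₂) ∧
      DGamma (tensorBip ρ₁ ρ₂) ≤ DGamma ρ₁ + Real.logb 2 (traceAbs (ptrans ρ₂))) ∧
    (∀ d : ℕ, 1 ≤ d →
      DGamma (tensorBip ρ₁ (maxEnt d)) = DGamma ρ₁ + Real.logb 2 (d : ℝ)) ∧
    ((ptrans ρ₂).PosSemidef → DGamma (tensorBip ρ₁ ρ₂) = DGamma ρ₁) := by
  refine ⟨⟨DGamma_add_le hρ₁ hρ₁tr hρ₂ hρ₂tr, DGamma_tensorBip_le hρ₁ hρ₁tr hρ₂ hρ₂tr⟩,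
    fun d hd => ?_, fun hppt => ?_⟩
  · have : NeZero d := ⟨by omega⟩
    have hpos : (maxEnt d).PosSemidef := maxEnt_eq d ▸ maxEntOn_posSemidef
    have htr : (maxEnt d).trace = 1 := maxEnt_eq d ▸ trace_maxEntOn
    have hle := DGamma_tensorBip_le hρ₁ hρ₁tr hpos htr
    rw [maxEnt_eq, traceAbs_ptrans_maxEntOn, Fintype.card_fin, ← maxEnt_eq] at hle
    linarith [DGamma_add_le hρ₁ hρ₁tr hpos htr, logb_le_DGamma_maxEnt hd]
  · have hle := DGamma_tensorBip_le hρ₁ hρ₁tr hρ₂ hρ₂tr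
    rw [traceAbs_eq_one hppt hρ₂tr, Real.logb_one, add_zero] at hle
    linarith [DGamma_add_le hρ₁ hρ₁tr hρ₂ hρ₂tr, DGamma_nonneg ρ₂]
end
end

section
/- Let ρ and σ be states on the same finite-dimensional Hilbert space, with the support of ρ contained in the support of σ, and let y be a real number with y > S(ρ||σ). Then limsup_{n→∞} Tr((ρ^{⊗n} − 2^{yn}·σ^{⊗n})₊) < 1. -/
open Matrix Filter
open scoped ComplexOrder

noncomputable section

/-- `n`-fold tensor power of a matrix on a single system. -/
def tpow1 {ι : Type*} (ρ : Matrix ι ι ℂ) (n : ℕ) : Matrix (Fin n → ι) (Fin n → ι) ℂ :=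
  fun x y => ∏ i, ρ (x i) (y i)

/-- Base-2 logarithm of a Hermitian matrix via the spectral theorem
(with the convention `log 0 = 0` on the kernel, and junk value `0` otherwise). -/
def hermLog2 {n : Type*} [Fintype n] [DecidableEq n] (A : Matrix n n ℂ) : Matrix n n ℂ :=
  if h : A.IsHermitian then
    (h.eigenvectorUnitary : Matrix n n ℂ) *
      Matrix.diagonal (fun i => ((Real.logb 2 (h.eigenvalues i) : ℝ) : ℂ)) *
      star (h.eigenvectorUnitary : Matrix n n ℂ)
  else 0

/-- Relative entropy `S(ρ‖σ) = Tr(ρ (log₂ ρ - log₂ σ))`. -/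
def relEnt {n : Type*} [Fintype n] [DecidableEq n] (ρ σ : Matrix n n ℂ) : ℝ :=
  ((ρ * (hermLog2 ρ - hermLog2 σ)).trace).re


theorem tpow1_mul {ι : Type*} [Fintype ι] (A B : Matrix ι ι ℂ) (n : ℕ) :
    tpow1 (A * B) n = tpow1 A n * tpow1 B n := by
  ext x y
  simp only [tpow1, Matrix.mul_apply, Finset.prod_univ_sum, Fintype.piFinset_univ,
    Finset.prod_mul_distrib]

theorem tpow1_conjTranspose {ι : Type*} (A : Matrix ι ι ℂ) (n : ℕ) :
    tpow1 Aᴴ n = (tpow1 A n)ᴴ := by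
  ext x y
  simp [tpow1, Matrix.conjTranspose_apply]

theorem tpow1_diagonal {ι : Type*} [DecidableEq ι] (d : ι → ℂ) (n : ℕ) :
    tpow1 (diagonal d) n = diagonal (fun x : Fin n → ι => ∏ k, d (x k)) := by
  ext x y
  by_cases h : x = y
  · subst h
    simp [tpow1]
  · obtain ⟨k, hk⟩ := Function.ne_iff.1 h
    rw [diagonal_apply_ne _ h]
    exact Finset.prod_eq_zero (Finset.mem_univ k) (diagonal_apply_ne _ hk)

theorem tpow1_one {ι : Type*} [DecidableEq ι] (n : ℕ) :
    tpow1 (1 : Matrix ι ι ℂ) n = 1 := by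
  rw [← diagonal_one, tpow1_diagonal]
  simp

theorem sum_sum_prod_eq_pow {ι : Type*} [Fintype ι] (f : ι → ι → ℝ) (n : ℕ) :
    ∑ x : Fin n → ι, ∑ y : Fin n → ι, ∏ k, f (x k) (y k) = (∑ i, ∑ j, f i j) ^ n := by
  classical
  have h : ∀ x : Fin n → ι, ∑ y : Fin n → ι, ∏ k, f (x k) (y k) = ∏ k, ∑ j, f (x k) j := by
    intro x
    rw [Finset.prod_univ_sum, Fintype.piFinset_univ]
  simp_rw [h]
  exact (Fintype.sum_pow (fun i => ∑ j, f i j) n).symm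

section OneShot

variable {m : Type*} [Fintype m] [DecidableEq m]

theorem tracePos_nonneg_s12 (A : Matrix m m ℂ) : 0 ≤ tracePos A := by
  unfold tracePos
  split_ifs
  · exact Finset.sum_nonneg fun i _ => le_max_right _ _
  · exact le_rfl

theorem isHermitian_conj_diagonal (U : Matrix m m ℂ) (r : m → ℝ) :
    (U * diagonal (fun i => (r i : ℂ)) * Uᴴ).IsHermitian :=
  isHermitian_mul_mul_conjTranspose _ <| by
    rw [isHermitian_diagonal_iff]
    intro i
    simp [isSelfAdjoint_iff]

theorem Matrix.IsHermitian.eq_conj_diagonal {A : Matrix m m ℂ} (hA : A.IsHermitian) :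
    A = (hA.eigenvectorUnitary : Matrix m m ℂ) *
      diagonal (fun i => (hA.eigenvalues i : ℂ)) * (hA.eigenvectorUnitary : Matrix m m ℂ)ᴴ := by
  conv_lhs => rw [hA.spectral_theorem]
  rfl

/-- The trace of the positive part of `A` is attained as `Tr (A Π)` for a projection `Π`. -/
theorem exists_projection_tracePos {A : Matrix m m ℂ} (hA : A.IsHermitian) :
    ∃ P : Matrix m m ℂ, Pᴴ = P ∧ P * P = P ∧ tracePos A = (A * P).trace.re := by
  set W : Matrix m m ℂ := (hA.eigenvectorUnitary : Matrix m m ℂ)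
  have hW : Wᴴ * W = 1 := Unitary.coe_star_mul_self hA.eigenvectorUnitary
  have hAW : A = W * diagonal (fun i => (hA.eigenvalues i : ℂ)) * Wᴴ := hA.eq_conj_diagonal
  set e : m → ℝ := fun i => if 0 < hA.eigenvalues i then 1 else 0
  refine ⟨W * diagonal (fun i => (e i : ℂ)) * Wᴴ, isHermitian_conj_diagonal W e, ?_, ?_⟩
  · calc _ = W * diagonal (fun i => (e i : ℂ)) * (Wᴴ * W) * diagonal (fun i => (e i : ℂ)) * Wᴴ := by
          simp only [Matrix.mul_assoc]
      _ = _ := by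
          rw [hW, Matrix.mul_one, Matrix.mul_assoc W, diagonal_mul_diagonal]
          congr 3
          ext i
          by_cases h : 0 < hA.eigenvalues i <;> simp [e, h]
  · have : (A * (W * diagonal (fun i => (e i : ℂ)) * Wᴴ)).trace =
        (diagonal (fun i => (hA.eigenvalues i : ℂ)) * diagonal (fun i => (e i : ℂ))).trace := by
      calc _ = (W * (diagonal (fun i => (hA.eigenvalues i : ℂ)) * (Wᴴ * W) *
            diagonal (fun i => (e i : ℂ))) * Wᴴ).trace := by
            conv_lhs => rw [hAW]
            simp only [Matrix.mul_assoc]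
        _ = _ := by
            rw [Matrix.trace_mul_cycle, hW, Matrix.one_mul, Matrix.mul_one]
    rw [this, diagonal_mul_diagonal, trace_diagonal, Complex.re_sum, tracePos, dif_pos hA]
    refine Finset.sum_congr rfl fun i _ => ?_
    by_cases h : 0 < hA.eigenvalues i
    · simp [e, h, h.le]
    · simp [e, h, not_lt.1 h]

/-- Expansion of `Tr (ρ Q)` for a projection `Q` in an eigenbasis of `ρ` and a second basis. -/
theorem trace_conj_diagonal_mul_projection {U V Q : Matrix m m ℂ} (r : m → ℝ)
    (hV : V * Vᴴ = 1) (hQ : Qᴴ = Q) (hQQ : Q * Q = Q) :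
    (U * diagonal (fun i => (r i : ℂ)) * Uᴴ * Q).trace.re =
      ∑ i, ∑ j, r i * Complex.normSq ((Uᴴ * Q * V) i j) := by
  have h : (U * diagonal (fun i => (r i : ℂ)) * Uᴴ * Q).trace =
      (diagonal (fun i => (r i : ℂ)) * ((Uᴴ * Q * V) * (Uᴴ * Q * V)ᴴ)).trace := by
    have h1 : (Uᴴ * Q * V) * (Uᴴ * Q * V)ᴴ = Uᴴ * Q * U := by
      calc _ = Uᴴ * Q * (V * Vᴴ) * Q * U := by
            simp only [conjTranspose_mul, conjTranspose_conjTranspose, hQ, Matrix.mul_assoc]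
        _ = _ := by rw [hV, Matrix.mul_one, Matrix.mul_assoc Uᴴ, hQQ]
    rw [h1, Matrix.trace_mul_comm _ (Uᴴ * Q * U), Matrix.mul_assoc, Matrix.mul_assoc,
      Matrix.trace_mul_comm U, Matrix.mul_assoc, Matrix.trace_mul_comm _ (Uᴴ * Q * U)]
  rw [h, Matrix.trace, Complex.re_sum]
  refine Finset.sum_congr rfl fun i _ => ?_
  rw [diag_apply, diagonal_mul, Complex.re_ofReal_mul, Matrix.mul_apply, Complex.re_sum,
    Finset.mul_sum]
  refine Finset.sum_congr rfl fun j _ => ?_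
  rw [conjTranspose_apply, ← starRingEnd_apply, Complex.mul_conj, Complex.ofReal_re]

/-- A lower bound for the quantum testing error in terms of the classical error of the
Nussbaum–Szkoła distributions. -/
theorem tracePos_sub_smul_le {U V : Matrix m m ℂ} (hU : U * Uᴴ = 1) (hV : V * Vᴴ = 1)
    {r s : m → ℝ} (hr : ∀ i, 0 ≤ r i) (hs : ∀ i, 0 ≤ s i) {T : ℝ} (hT : 0 ≤ T) :
    tracePos (U * diagonal (fun i => (r i : ℂ)) * Uᴴ -
        (T : ℂ) • (V * diagonal (fun i => (s i : ℂ)) * Vᴴ)) ≤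
      (∑ i, r i) -
        2⁻¹ * ∑ i, ∑ j, min (r i) (T * s j) * Complex.normSq ((Uᴴ * V) i j) := by
  have hA : (U * diagonal (fun i => (r i : ℂ)) * Uᴴ -
        (T : ℂ) • (V * diagonal (fun i => (s i : ℂ)) * Vᴴ)).IsHermitian := by
    refine (isHermitian_conj_diagonal U r).sub ?_
    rw [IsHermitian, conjTranspose_smul, (isHermitian_conj_diagonal V s).eq]
    simp
  obtain ⟨P, hP, hPP, htr⟩ := exists_projection_tracePos hA
  have hP' : (1 - P)ᴴ = 1 - P := by simp [hP]
  have hPP' : (1 - P) * (1 - P) = 1 - P := by simp [mul_sub, sub_mul, hPP]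
  have hρ : (U * diagonal (fun i => (r i : ℂ)) * Uᴴ).trace.re = ∑ i, r i := by
    rw [Matrix.trace_mul_cycle, mul_eq_one_comm.1 hU, Matrix.one_mul, trace_diagonal,
      Complex.re_sum]
    simp
  have h1 := trace_conj_diagonal_mul_projection (U := U) r hV hP' hPP'
  have h2 := trace_conj_diagonal_mul_projection (U := V) s hU hP hPP
  rw [Matrix.mul_sub, Matrix.mul_one, Matrix.trace_sub, Complex.sub_re, hρ] at h1
  rw [Matrix.sub_mul, Matrix.smul_mul, Matrix.trace_sub, Matrix.trace_smul, Complex.sub_re,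
    smul_eq_mul, Complex.re_ofReal_mul, h2] at htr
  rw [Finset.sum_comm] at htr
  have key : ∑ i, ∑ j, min (r i) (T * s j) * Complex.normSq ((Uᴴ * V) i j) ≤
      2 * (∑ i, ∑ j, r i * Complex.normSq ((Uᴴ * (1 - P) * V) i j) +
        T * ∑ i, ∑ j, s j * Complex.normSq ((Vᴴ * P * U) j i)) := by
    simp only [Finset.mul_sum, ← Finset.sum_add_distrib]
    refine Finset.sum_le_sum fun i _ => Finset.sum_le_sum fun j _ => ?_
    have hM : Complex.normSq ((Vᴴ * P * U) j i) = Complex.normSq ((Uᴴ * P * V) i j) := by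
      have : Vᴴ * P * U = (Uᴴ * P * V)ᴴ := by
        simp [conjTranspose_mul, hP, Matrix.mul_assoc]
      rw [this, conjTranspose_apply, ← starRingEnd_apply, Complex.normSq_conj]
    have hsum : (Uᴴ * V) i j = (Uᴴ * (1 - P) * V) i j + (Uᴴ * P * V) i j := by
      rw [← Matrix.add_apply, ← Matrix.add_mul, ← Matrix.mul_add]
      simp
    rw [hM, hsum]
    generalize (Uᴴ * (1 - P) * V) i j = a
    generalize (Uᴴ * P * V) i j = b
    have hab : Complex.normSq (a + b) ≤ 2 * Complex.normSq a + 2 * Complex.normSq b := by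
      simp only [Complex.normSq_apply, Complex.add_re, Complex.add_im]
      nlinarith [sq_nonneg (a.re - b.re), sq_nonneg (a.im - b.im)]
    have ha := Complex.normSq_nonneg a
    have hb := Complex.normSq_nonneg b
    have hmin : 0 ≤ min (r i) (T * s j) := le_min (hr i) (mul_nonneg hT (hs j))
    have e1 := mul_le_mul_of_nonneg_left hab hmin
    have e2 := mul_le_mul_of_nonneg_right (min_le_left (r i) (T * s j)) ha
    have e3 := mul_le_mul_of_nonneg_right (min_le_right (r i) (T * s j)) hb
    linarith
  linarith

end OneShot

theorem tpow1_conj_diagonal {ι : Type*} [Fintype ι] [DecidableEq ι] (U : Matrix ι ι ℂ)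
    (r : ι → ℝ) (n : ℕ) :
    tpow1 (U * diagonal (fun i => (r i : ℂ)) * Uᴴ) n =
      tpow1 U n * diagonal (fun x : Fin n → ι => ((∏ k, r (x k) : ℝ) : ℂ)) * (tpow1 U n)ᴴ := by
  rw [tpow1_mul, tpow1_mul, tpow1_diagonal, tpow1_conjTranspose]
  simp only [Complex.ofReal_prod]

theorem exists_pos_sum_mul_exp_lt_one {κ : Type*} [Fintype κ] {p L : κ → ℝ}
    (hp : ∑ i, p i = 1) (hL : ∑ i, p i * L i < 0) :
    ∃ t > 0, ∑ i, p i * Real.exp (t * L i) < 1 := by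
  have hd : HasDerivAt (fun t : ℝ => ∑ i, p i * Real.exp (t * L i)) (∑ i, p i * L i) 0 := by
    refine HasDerivAt.fun_sum fun i _ => ?_
    have := (((hasDerivAt_id (0 : ℝ)).mul_const (L i)).exp).const_mul (p i)
    simpa using this
  have h := (hasDerivAt_iff_tendsto_slope.1 hd).eventually (gt_mem_nhds hL)
  have h' := h.filter_mono (nhdsWithin_mono (0 : ℝ)
    (show Set.Ioi (0 : ℝ) ⊆ {0}ᶜ from fun x hx => ne_of_gt hx))
  obtain ⟨t, ht, ht0⟩ := (h'.and self_mem_nhdsWithin).exists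
  refine ⟨t, ht0, ?_⟩
  have ht0' : 0 < t := ht0
  simp only [slope_def_field, sub_zero, zero_mul, Real.exp_zero, mul_one, hp] at ht
  have := (div_lt_iff₀ ht0').1 ht
  linarith

/-- Chernoff bound for the testing error of i.i.d. weights. -/
theorem exists_one_sub_pow_le_sum_min {ι : Type*} [Fintype ι] {r s : ι → ℝ} {w : ι → ι → ℝ}
    (hr : ∀ i, 0 ≤ r i) (hs : ∀ i, 0 ≤ s i) (hw : ∀ i j, 0 ≤ w i j)
    (hsupp : ∀ i j, s j = 0 → r i * w i j = 0) (hsum : ∑ i, ∑ j, r i * w i j = 1) {y : ℝ}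
    (hy : ∑ i, ∑ j, r i * w i j * (Real.logb 2 (r i) - Real.logb 2 (s j)) < y) :
    ∃ F : ℝ, 0 ≤ F ∧ F < 1 ∧ ∀ n : ℕ, 1 - F ^ n ≤
      ∑ x : Fin n → ι, ∑ z : Fin n → ι,
        min (∏ k, r (x k)) ((2 : ℝ) ^ (y * n) * ∏ k, s (z k)) * ∏ k, w (x k) (z k) := by
  set L : ι → ι → ℝ := fun i j => Real.logb 2 (r i) - Real.logb 2 (s j) - y with hLdef
  have hL : ∑ q : ι × ι, r q.1 * w q.1 q.2 * L q.1 q.2 < 0 := by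
    rw [Fintype.sum_prod_type]
    simp only [hLdef, mul_sub _ _ y, Finset.sum_sub_distrib, ← Finset.sum_mul, hsum]
    linarith
  obtain ⟨t, ht, hF⟩ := exists_pos_sum_mul_exp_lt_one
    (by rw [Fintype.sum_prod_type]; exact hsum) hL
  rw [Fintype.sum_prod_type] at hF
  have hP : ∀ i j, 0 ≤ r i * w i j := fun i j => mul_nonneg (hr i) (hw i j)
  refine ⟨_, Finset.sum_nonneg fun i _ => Finset.sum_nonneg fun j _ =>
    mul_nonneg (hP i j) (Real.exp_nonneg _), hF, fun n => ?_⟩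
  have h1 : (1 : ℝ) = ∑ x : Fin n → ι, ∑ z : Fin n → ι, ∏ k, r (x k) * w (x k) (z k) := by
    rw [sum_sum_prod_eq_pow (fun i j => r i * w i j), hsum, one_pow]
  rw [← sum_sum_prod_eq_pow, h1]
  simp only [← Finset.sum_sub_distrib]
  refine Finset.sum_le_sum fun x _ => Finset.sum_le_sum fun z _ => ?_
  have hR : 0 ≤ ∏ k, r (x k) := Finset.prod_nonneg fun k _ => hr _
  have hW : 0 ≤ ∏ k, w (x k) (z k) := Finset.prod_nonneg fun k _ => hw _ _
  have hS : 0 ≤ (2 : ℝ) ^ (y * n) * ∏ k, s (z k) :=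
    mul_nonneg (by positivity) (Finset.prod_nonneg fun k _ => hs _)
  have hmin := mul_nonneg (le_min hR hS) hW
  rw [Finset.prod_mul_distrib (f := fun k => r (x k) * w (x k) (z k)), ← Real.exp_sum,
    ← Finset.mul_sum]
  by_cases h0 : ∏ k, r (x k) * w (x k) (z k) = 0
  · simpa [h0] using hmin
  have hpos : ∀ k, r (x k) * w (x k) (z k) ≠ 0 := fun k =>
    Finset.prod_ne_zero_iff.1 h0 k (Finset.mem_univ k)
  have hratio : ∏ k, r (x k) =
      (2 : ℝ) ^ (∑ k, L (x k) (z k)) * ((2 : ℝ) ^ (y * n) * ∏ k, s (z k)) := by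
    have hk : ∀ k, r (x k) = (2 : ℝ) ^ L (x k) (z k) * ((2 : ℝ) ^ y * s (z k)) := by
      intro k
      have hrk : 0 < r (x k) := (hr _).lt_of_ne' (left_ne_zero_of_mul (hpos k))
      have hsk : 0 < s (z k) := (hs _).lt_of_ne' fun h => hpos k (hsupp _ _ h)
      conv_rhs => rw [← Real.rpow_logb two_pos (by norm_num) hsk]
      rw [← Real.rpow_add two_pos, ← Real.rpow_add two_pos, hLdef]
      ring_nf
      exact (Real.rpow_logb two_pos (by norm_num) hrk).symm
    rw [Finset.prod_congr rfl fun k _ => hk k, Finset.prod_mul_distrib, Finset.prod_mul_distrib,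
      Real.rpow_sum_of_pos two_pos]
    simp [Real.rpow_mul]
  have hexp := Real.exp_nonneg (t * ∑ k, L (x k) (z k))
  have hPn : 0 ≤ ∏ k, r (x k) * w (x k) (z k) := Finset.prod_nonneg fun k _ => hP _ _
  rcases le_or_gt (∑ k, L (x k) (z k)) 0 with hle | hgt
  · have : ∏ k, r (x k) ≤ (2 : ℝ) ^ (y * n) * ∏ k, s (z k) := by
      rw [hratio]
      exact mul_le_of_le_one_left hS (Real.rpow_le_one_of_one_le_of_nonpos one_le_two hle)
    rw [min_eq_left this, ← Finset.prod_mul_distrib]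
    linarith [mul_nonneg hPn hexp]
  · have : 1 ≤ Real.exp (t * ∑ k, L (x k) (z k)) := Real.one_le_exp (mul_pos ht hgt).le
    linarith [mul_le_mul_of_nonneg_left this hPn]

section Spectral

variable {m : Type*} [Fintype m] [DecidableEq m]

theorem trace_conj_diagonal_mul_conj_diagonal (U V : Matrix m m ℂ) (r d : m → ℝ) :
    (U * diagonal (fun i => (r i : ℂ)) * Uᴴ *
        (V * diagonal (fun i => (d i : ℂ)) * Vᴴ)).trace.re =
      ∑ i, ∑ j, r i * Complex.normSq ((Uᴴ * V) i j) * d j := by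
  have h : (U * diagonal (fun i => (r i : ℂ)) * Uᴴ *
      (V * diagonal (fun i => (d i : ℂ)) * Vᴴ)).trace =
      (diagonal (fun i => (r i : ℂ)) * (Uᴴ * V) * diagonal (fun i => (d i : ℂ)) *
        (Uᴴ * V)ᴴ).trace := by
    rw [conjTranspose_mul, conjTranspose_conjTranspose, ← Matrix.mul_assoc _ Vᴴ U,
      Matrix.trace_mul_comm _ U]
    simp only [Matrix.mul_assoc]
  rw [h, Matrix.trace, Complex.re_sum]
  refine Finset.sum_congr rfl fun i _ => ?_
  rw [diag_apply, Matrix.mul_apply, Complex.re_sum]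
  refine Finset.sum_congr rfl fun j _ => ?_
  rw [mul_diagonal, diagonal_mul, conjTranspose_apply, ← starRingEnd_apply, mul_right_comm,
    mul_assoc (r i : ℂ), Complex.mul_conj, ← Complex.ofReal_mul, ← Complex.ofReal_mul,
    Complex.ofReal_re]

theorem sum_normSq_row_eq_one {G : Matrix m m ℂ} (hG : G * Gᴴ = 1) (i : m) :
    ∑ j, Complex.normSq (G i j) = 1 := by
  have h := congrArg Complex.re (congrFun (congrFun hG i) i)
  rw [Matrix.mul_apply, Complex.re_sum, one_apply_eq, Complex.one_re] at h
  rw [← h]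
  refine Finset.sum_congr rfl fun j _ => ?_
  rw [conjTranspose_apply, ← starRingEnd_apply, Complex.mul_conj, Complex.ofReal_re]

/-- The relative entropy equals that of the Nussbaum–Szkoła distributions. -/
theorem relEnt_eq_sum {ρ σ : Matrix m m ℂ} (hρ : ρ.IsHermitian) (hσ : σ.IsHermitian) :
    relEnt ρ σ = ∑ i, ∑ j, hρ.eigenvalues i *
      Complex.normSq (((hρ.eigenvectorUnitary : Matrix m m ℂ)ᴴ *
        (hσ.eigenvectorUnitary : Matrix m m ℂ)) i j) *
      (Real.logb 2 (hρ.eigenvalues i) - Real.logb 2 (hσ.eigenvalues j)) := by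
  set U : Matrix m m ℂ := (hρ.eigenvectorUnitary : Matrix m m ℂ)
  set V : Matrix m m ℂ := (hσ.eigenvectorUnitary : Matrix m m ℂ)
  have hU : Uᴴ * U = 1 := Unitary.coe_star_mul_self hρ.eigenvectorUnitary
  have hV' : V * Vᴴ = 1 := Unitary.coe_mul_star_self hσ.eigenvectorUnitary
  have hG : (Uᴴ * V) * (Uᴴ * V)ᴴ = 1 := by
    rw [conjTranspose_mul, conjTranspose_conjTranspose, Matrix.mul_assoc, ← Matrix.mul_assoc V,
      hV', Matrix.one_mul, hU]
  have hlogρ : hermLog2 ρ =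
      U * diagonal (fun i => ((Real.logb 2 (hρ.eigenvalues i) : ℝ) : ℂ)) * Uᴴ := dif_pos hρ
  have hlogσ : hermLog2 σ =
      V * diagonal (fun i => ((Real.logb 2 (hσ.eigenvalues i) : ℝ) : ℂ)) * Vᴴ := dif_pos hσ
  have hρe : ρ = U * diagonal (fun i => (hρ.eigenvalues i : ℂ)) * Uᴴ := hρ.eq_conj_diagonal
  have e1 := trace_conj_diagonal_mul_conj_diagonal U U hρ.eigenvalues
    (fun i => Real.logb 2 (hρ.eigenvalues i))
  have e2 := trace_conj_diagonal_mul_conj_diagonal U V hρ.eigenvalues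
    (fun i => Real.logb 2 (hσ.eigenvalues i))
  rw [← hρe, ← hlogρ, hU] at e1
  rw [← hρe, ← hlogσ] at e2
  rw [relEnt, Matrix.mul_sub, Matrix.trace_sub, Complex.sub_re, e1, e2,
    ← Finset.sum_sub_distrib]
  refine Finset.sum_congr rfl fun i _ => ?_
  simp only [mul_sub, Finset.sum_sub_distrib]
  congr 1
  rw [← Finset.sum_mul, ← Finset.mul_sum, sum_normSq_row_eq_one hG,
    Finset.sum_eq_single i (fun j _ hj => by simp [one_apply_ne hj.symm]) (by simp)]
  simp

theorem eigenvalue_mul_overlap_eq_zero {ρ σ : Matrix m m ℂ} (hρ : ρ.IsHermitian)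
    (hσ : σ.IsHermitian) (hsupp : ∀ v : m → ℂ, σ *ᵥ v = 0 → ρ *ᵥ v = 0) {i j : m}
    (hj : hσ.eigenvalues j = 0) :
    hρ.eigenvalues i * Complex.normSq (((hρ.eigenvectorUnitary : Matrix m m ℂ)ᴴ *
        (hσ.eigenvectorUnitary : Matrix m m ℂ)) i j) = 0 := by
  set U : Matrix m m ℂ := (hρ.eigenvectorUnitary : Matrix m m ℂ)
  set V : Matrix m m ℂ := (hσ.eigenvectorUnitary : Matrix m m ℂ)
  have hU : Uᴴ * U = 1 := Unitary.coe_star_mul_self hρ.eigenvectorUnitary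
  have hv : V.col j = ⇑(hσ.eigenvectorBasis j) := rfl
  have hσv : σ *ᵥ V.col j = 0 := by
    rw [hv, hσ.mulVec_eigenvectorBasis, hj, zero_smul]
  have hρe : ρ = U * diagonal (fun i => (hρ.eigenvalues i : ℂ)) * Uᴴ := hρ.eq_conj_diagonal
  have h : Uᴴ * ρ = diagonal (fun i => (hρ.eigenvalues i : ℂ)) * Uᴴ := by
    conv_lhs => rw [hρe]
    rw [← Matrix.mul_assoc, ← Matrix.mul_assoc, hU, Matrix.one_mul]
  have h0 : (Uᴴ * ρ * V) i j = 0 := by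
    rw [Matrix.mul_assoc, Matrix.mul_apply]
    refine Finset.sum_eq_zero fun k _ => ?_
    have : (ρ * V) k j = (ρ *ᵥ V.col j) k := rfl
    rw [this, hsupp _ hσv, Pi.zero_apply, mul_zero]
  rw [h, Matrix.mul_assoc, diagonal_mul, mul_eq_zero] at h0
  rcases h0 with h0 | h0
  · rw [Complex.ofReal_eq_zero.1 h0, zero_mul]
  · rw [h0, map_zero, mul_zero]

end Spectral

/-- If `y > S(ρ‖σ)` then `limsupₙ Tr((ρ^{⊗n} - 2^{yn} σ^{⊗n})₊) < 1`. -/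
theorem limsup_tracePos_lt_one {N : ℕ}
    (ρ σ : Matrix (Fin N) (Fin N) ℂ)
    (hρ : ρ.PosSemidef) (hρtr : ρ.trace = 1)
    (hσ : σ.PosSemidef) (hσtr : σ.trace = 1)
    (hsupp : ∀ v : Fin N → ℂ, σ *ᵥ v = 0 → ρ *ᵥ v = 0)
    (y : ℝ) (hy : relEnt ρ σ < y) :
    Filter.limsup
      (fun n : ℕ =>
        tracePos (tpow1 ρ n - (((2 : ℝ) ^ (y * (n : ℝ)) : ℝ) : ℂ) • tpow1 σ n))
      Filter.atTop < 1 := by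
  have hρH := hρ.isHermitian
  have hσH := hσ.isHermitian
  set U : Matrix (Fin N) (Fin N) ℂ := (hρH.eigenvectorUnitary : Matrix (Fin N) (Fin N) ℂ)
  set V : Matrix (Fin N) (Fin N) ℂ := (hσH.eigenvectorUnitary : Matrix (Fin N) (Fin N) ℂ)
  set r := hρH.eigenvalues
  set s := hσH.eigenvalues
  have hU : Uᴴ * U = 1 := Unitary.coe_star_mul_self hρH.eigenvectorUnitary
  have hU' : U * Uᴴ = 1 := Unitary.coe_mul_star_self hρH.eigenvectorUnitary
  have hV' : V * Vᴴ = 1 := Unitary.coe_mul_star_self hσH.eigenvectorUnitary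
  have hG : (Uᴴ * V) * (Uᴴ * V)ᴴ = 1 := by
    rw [conjTranspose_mul, conjTranspose_conjTranspose, Matrix.mul_assoc, ← Matrix.mul_assoc V,
      hV', Matrix.one_mul, hU]
  have hρe : ρ = U * diagonal (fun i => (r i : ℂ)) * Uᴴ := hρH.eq_conj_diagonal
  have hσe : σ = V * diagonal (fun i => (s i : ℂ)) * Vᴴ := hσH.eq_conj_diagonal
  have hr : ∀ i, 0 ≤ r i := hρ.eigenvalues_nonneg
  have hs : ∀ i, 0 ≤ s i := hσ.eigenvalues_nonneg
  have hrsum : ∑ i, r i = 1 := by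
    have h := hρH.trace_eq_sum_eigenvalues
    rw [hρtr] at h
    have h' : ((∑ i, r i : ℝ) : ℂ) = 1 := by
      rw [Complex.ofReal_sum]
      exact h.symm
    exact_mod_cast h'
  have hsum : ∑ i, ∑ j, r i * Complex.normSq ((Uᴴ * V) i j) = 1 := by
    simp only [← Finset.mul_sum, sum_normSq_row_eq_one hG, mul_one, hrsum]
  rw [relEnt_eq_sum hρH hσH] at hy
  obtain ⟨F, hF0, hF1, hF⟩ := exists_one_sub_pow_le_sum_min hr hs
    (fun i j => Complex.normSq_nonneg ((Uᴴ * V) i j))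
    (fun i j hj => eigenvalue_mul_overlap_eq_zero hρH hσH hsupp hj) hsum hy
  have hbound : ∀ n : ℕ,
      tracePos (tpow1 ρ n - (((2 : ℝ) ^ (y * (n : ℝ)) : ℝ) : ℂ) • tpow1 σ n) ≤
        1 - 2⁻¹ * (1 - F ^ n) := by
    intro n
    have hUn : tpow1 U n * (tpow1 U n)ᴴ = 1 := by
      rw [← tpow1_conjTranspose, ← tpow1_mul, hU', tpow1_one]
    have hVn : tpow1 V n * (tpow1 V n)ᴴ = 1 := by
      rw [← tpow1_conjTranspose, ← tpow1_mul, hV', tpow1_one]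
    have h := tracePos_sub_smul_le hUn hVn
      (r := fun x : Fin n → Fin N => ∏ k, r (x k)) (s := fun x : Fin n → Fin N => ∏ k, s (x k))
      (fun x => Finset.prod_nonneg fun k _ => hr _) (fun x => Finset.prod_nonneg fun k _ => hs _)
      (T := (2 : ℝ) ^ (y * (n : ℝ))) (by positivity)
    rw [← tpow1_conj_diagonal, ← tpow1_conj_diagonal, ← hρe, ← hσe, ← tpow1_conjTranspose,
      ← tpow1_mul] at h
    have hone : ∑ x : Fin n → Fin N, ∏ k, r (x k) = 1 := by
      rw [← Fintype.sum_pow, hrsum, one_pow]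
    simp only [hone, tpow1, map_prod] at h
    linarith [hF n]
  have hlim : ∀ᶠ n : ℕ in atTop, F ^ n < 2⁻¹ :=
    (tendsto_pow_atTop_nhds_zero_of_lt_one hF0 hF1).eventually (gt_mem_nhds (by norm_num))
  refine lt_of_le_of_lt (limsup_le_of_le (a := 3 / 4) ?_ ?_) (by norm_num)
  · exact (isBoundedUnder_of ⟨0, fun n => tracePos_nonneg_s12 _⟩ :
      IsBoundedUnder (· ≥ ·) atTop _).isCoboundedUnder_le
  · filter_upwards [hlim] with n hn
    linarith [hbound n]
end
end
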